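/- Let L be an agreeable pseudo-hitomezashi loop admitting a split at longitude i0, and let L1 and L2 be the pseudo-hitomezashi strands into which L breaks when the split is applied. Then L1 and L2 are agreeable pseudo-hitomezashi loops, and neither is contained in the interior of the other. -/

import Mathlib

/-- A stitch is a unit segment of the grid: `vert i j` is the vertical segment from
`(i,j)` to `(i,j+1)`; `horiz i j` is the horizontal segment from `(i,j)` to `(i+1,j)`. -/
inductive Stitch : Type
  | vert : ℤ → ℤ → Stitch
  | horiz : ℤ → ℤ → Stitch
  deriving DecidableEq

/-- Membership of a stitch in the hitomezashi pattern with labels `ε` (vertical lines)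
and `η` (horizontal lines). -/
def Stitch.InPattern (ε η : ℤ → ZMod 2) : Stitch → Prop
  | .vert i j => (j : ZMod 2) = ε i
  | .horiz i j => (i : ZMod 2) = η j

/-- The stitch as a subset of the plane. -/
def Stitch.seg : Stitch → Set (ℝ × ℝ)
  | .vert i j => segment ℝ ((i : ℝ), (j : ℝ)) ((i : ℝ), (j : ℝ) + 1)
  | .horiz i j => segment ℝ ((i : ℝ), (j : ℝ)) ((i : ℝ) + 1, (j : ℝ))

/-- The union of the segments of a set of stitches. -/
def curveOf (S : Set Stitch) : Set (ℝ × ℝ) := ⋃ s ∈ S, s.seg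

/-- `C` is a simple closed curve: it is homeomorphic to a circle. -/
def IsCircle (C : Set (ℝ × ℝ)) : Prop :=
  Nonempty (C ≃ₜ Metric.sphere (0 : ℝ × ℝ) 1)

/-- The interior of a closed curve `C`: the union of the bounded connected
components of its complement. -/
def intOf (C : Set (ℝ × ℝ)) : Set (ℝ × ℝ) :=
  {p | p ∉ C ∧ Bornology.IsBounded (connectedComponentIn Cᶜ p)}

/-- The exterior of a closed curve `C`: the union of the unbounded connected
components of its complement. -/
def extOf (C : Set (ℝ × ℝ)) : Set (ℝ × ℝ) :=
  {p | p ∉ C ∧ ¬ Bornology.IsBounded (connectedComponentIn Cᶜ p)}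

/-- The open unit cell with southwest corner `(i,j)`. -/
def cell (i j : ℤ) : Set (ℝ × ℝ) :=
  Set.Ioo (i : ℝ) ((i : ℝ) + 1) ×ˢ Set.Ioo (j : ℝ) ((j : ℝ) + 1)

/-- A hitomezashi loop in the pattern with labels `ε`, `η`: a (finite) set of stitches
of the pattern whose union is a simple closed curve. -/
structure HLoop (ε η : ℤ → ZMod 2) where
  stitches : Finset Stitch
  inPattern : ∀ s ∈ stitches, s.InPattern ε η
  isCircle : IsCircle (curveOf ↑stitches)

/-- The set of stitches of the hitomezashi pattern with labels `ε`, `η`. -/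
def patternSet (ε η : ℤ → ZMod 2) : Set Stitch := {s | s.InPattern ε η}

/-- A local move at longitude `k + 1/2`: the two vertical stitches `vert k j` and
`vert (k+1) j` are replaced by the two horizontal stitches `horiz k j` and `horiz k (j+1)`;
it may be applied only when those horizontal stitches are absent. -/
def LocalMoveAt (k : ℤ) (S T : Set Stitch) : Prop :=
  ∃ j : ℤ, Stitch.vert k j ∈ S ∧ Stitch.vert (k+1) j ∈ S ∧
    Stitch.horiz k j ∉ S ∧ Stitch.horiz k (j+1) ∉ S ∧
    T = (S \ {Stitch.vert k j, Stitch.vert (k+1) j}) ∪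
      {Stitch.horiz k j, Stitch.horiz k (j+1)}

/-- A square deletion at longitude `k + 1/2`: all four stitches of a unit square
centered at longitude `k + 1/2` are deleted. -/
def SquareDeletionAt (k : ℤ) (S T : Set Stitch) : Prop :=
  ∃ j : ℤ, Stitch.vert k j ∈ S ∧ Stitch.vert (k+1) j ∈ S ∧
    Stitch.horiz k j ∈ S ∧ Stitch.horiz k (j+1) ∈ S ∧
    T = S \ {Stitch.vert k j, Stitch.vert (k+1) j, Stitch.horiz k j, Stitch.horiz k (j+1)}

/-- `S` is a pseudo-hitomezashi pattern with respect to longitude `k + 1/2`: it is obtained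
from the hitomezashi pattern with labels `ε`, `η` by applying finitely many local moves and
square deletions at longitude `k + 1/2`. -/
def IsPseudoPattern (ε η : ℤ → ZMod 2) (k : ℤ) (S : Set Stitch) : Prop :=
  Relation.ReflTransGen (fun A B => LocalMoveAt k A B ∨ SquareDeletionAt k A B)
    (patternSet ε η) S

/-- A loop `C` (oriented counterclockwise, interior on the left) is agreeable for
longitude `k + 1/2`: its vertical stitches at longitude `k` are all oriented north-to-south
and those at longitude `k+1` are all oriented south-to-north; equivalently, the unit cell
between longitudes `k` and `k+1` adjacent to any such stitch lies in the interior of `C`. -/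
def AgreeableAt (k : ℤ) (C : Set (ℝ × ℝ)) : Prop :=
  ∀ j : ℤ, ((Stitch.vert k j).seg ⊆ C ∨ (Stitch.vert (k+1) j).seg ⊆ C) → cell k j ⊆ intOf C

namespace Hitomezashi

/-- Every grid vertex meets exactly zero or two stitches of `S`. -/
def TwoRegular (S : Set Stitch) : Prop := ∀ x y : ℤ,
  ((Stitch.vert x y ∈ S ↔ Stitch.vert x (y - 1) ∈ S) ↔
    (Stitch.horiz x y ∈ S ↔ Stitch.horiz (x - 1) y ∈ S)) ∧
  ¬ (Stitch.vert x y ∈ S ∧ Stitch.vert x (y - 1) ∈ S ∧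
    Stitch.horiz x y ∈ S ∧ Stitch.horiz (x - 1) y ∈ S)

theorem zmod_two_sub_one_eq_iff (a b : ZMod 2) : a - 1 = b ↔ ¬ a = b := by
  revert a b; decide

theorem twoRegular_patternSet (ε η : ℤ → ZMod 2) : TwoRegular (patternSet ε η) := by
  intro x y
  simp only [patternSet, Set.mem_ofPred_eq, Stitch.InPattern, Int.cast_sub, Int.cast_one,
    zmod_two_sub_one_eq_iff]
  tauto

theorem TwoRegular.localMove {k : ℤ} {S T : Set Stitch} (hS : TwoRegular S)
    (h : LocalMoveAt k S T) : TwoRegular T := by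
  obtain ⟨j, h1, h2, h3, h4, rfl⟩ := h
  intro x y
  have hxy := hS x y
  have hx : x = k ∨ x = k + 1 ∨ (x ≠ k ∧ x ≠ k + 1 ∧ x - 1 ≠ k) := by omega
  have hy : y = j ∨ y = j + 1 ∨ (y ≠ j ∧ y ≠ j + 1 ∧ y - 1 ≠ j) := by omega
  clear hS
  simp only [Set.mem_union, Set.mem_sdiff, Set.mem_insert_iff, Set.mem_singleton_iff,
    Stitch.vert.injEq, Stitch.horiz.injEq, reduceCtorEq, or_false]
  rcases hx with rfl | rfl | ⟨hx1, hx2, hx3⟩ <;> rcases hy with rfl | rfl | ⟨hy1, hy2, hy3⟩ <;>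
    simp_all

theorem TwoRegular.squareDeletion {k : ℤ} {S T : Set Stitch} (hS : TwoRegular S)
    (h : SquareDeletionAt k S T) : TwoRegular T := by
  obtain ⟨j, h1, h2, h3, h4, rfl⟩ := h
  intro x y
  have hxy := hS x y
  have hx : x = k ∨ x = k + 1 ∨ (x ≠ k ∧ x ≠ k + 1 ∧ x - 1 ≠ k) := by omega
  have hy : y = j ∨ y = j + 1 ∨ (y ≠ j ∧ y ≠ j + 1 ∧ y - 1 ≠ j) := by omega
  clear hS
  simp only [Set.mem_sdiff, Set.mem_insert_iff, Set.mem_singleton_iff,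
    Stitch.vert.injEq, Stitch.horiz.injEq, reduceCtorEq, or_false, false_or]
  rcases hx with rfl | rfl | ⟨hx1, hx2, hx3⟩ <;> rcases hy with rfl | rfl | ⟨hy1, hy2, hy3⟩ <;>
    simp_all

theorem twoRegular_of_isPseudoPattern {ε η : ℤ → ZMod 2} {k : ℤ} {S : Set Stitch}
    (h : IsPseudoPattern ε η k S) : TwoRegular S := by
  induction h with
  | refl => exact twoRegular_patternSet ε η
  | tail _ hstep ih => exact hstep.elim ih.localMove ih.squareDeletion

/-- The endpoints of a stitch. -/
def ends : Stitch → Set (ℤ × ℤ)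
  | .vert x y => {(x, y), (x, y + 1)}
  | .horiz x y => {(x, y), (x + 1, y)}

/-- Adjacency of grid vertices. -/
def Adj (u w : ℤ × ℤ) : Prop :=
  w = (u.1 + 1, u.2) ∨ w = (u.1, u.2 + 1) ∨ w = (u.1 - 1, u.2) ∨ w = (u.1, u.2 - 1)

/-- The stitch joining two adjacent vertices. -/
def edge (u w : ℤ × ℤ) : Stitch :=
  if u.1 = w.1 then .vert u.1 (min u.2 w.2) else .horiz (min u.1 w.1) u.2

/-- The cell to the left of the directed edge from `u` to `w`. -/
def left (u w : ℤ × ℤ) : ℤ × ℤ :=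
  (u.1 + (w.1 - u.1 - (w.2 - u.2) - 1) / 2, u.2 + (w.1 - u.1 + (w.2 - u.2) - 1) / 2)

section Coordinates
variable (x y : ℤ)

@[simp] theorem edge_east : edge (x, y) (x + 1, y) = .horiz x y := by simp [edge]
@[simp] theorem edge_west : edge (x, y) (x - 1, y) = .horiz (x - 1) y := by
  simp [edge]; omega
@[simp] theorem edge_north : edge (x, y) (x, y + 1) = .vert x y := by simp [edge]
@[simp] theorem edge_south : edge (x, y) (x, y - 1) = .vert x (y - 1) := by simp [edge]
@[simp] theorem edge_east' : edge (x - 1, y) (x, y) = .horiz (x - 1) y := by simp [edge]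
@[simp] theorem edge_west' : edge (x + 1, y) (x, y) = .horiz x y := by simp [edge]
@[simp] theorem edge_north' : edge (x, y - 1) (x, y) = .vert x (y - 1) := by simp [edge]
@[simp] theorem edge_south' : edge (x, y + 1) (x, y) = .vert x y := by simp [edge]

@[simp] theorem left_east : left (x, y) (x + 1, y) = (x, y) := by
  simp only [left, Prod.mk.injEq]; omega
@[simp] theorem left_west : left (x, y) (x - 1, y) = (x - 1, y - 1) := by
  simp only [left, Prod.mk.injEq]; omega
@[simp] theorem left_north : left (x, y) (x, y + 1) = (x - 1, y) := by
  simp only [left, Prod.mk.injEq]; omega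
@[simp] theorem left_south : left (x, y) (x, y - 1) = (x, y - 1) := by
  simp only [left, Prod.mk.injEq]; omega
@[simp] theorem left_east' : left (x - 1, y) (x, y) = (x - 1, y) := by
  simp only [left, Prod.mk.injEq]; omega
@[simp] theorem left_west' : left (x + 1, y) (x, y) = (x, y - 1) := by
  simp only [left, Prod.mk.injEq]; omega
@[simp] theorem left_north' : left (x, y - 1) (x, y) = (x - 1, y - 1) := by
  simp only [left, Prod.mk.injEq]; omega
@[simp] theorem left_south' : left (x, y + 1) (x, y) = (x, y) := by
  simp only [left, Prod.mk.injEq]; omega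

end Coordinates

theorem Adj.symm {u w : ℤ × ℤ} (h : Adj u w) : Adj w u := by
  obtain ⟨x, y⟩ := u
  rcases h with rfl | rfl | rfl | rfl <;> simp [Adj]

theorem Adj.ne {u w : ℤ × ℤ} (h : Adj u w) : u ≠ w := by
  obtain ⟨x, y⟩ := u
  rcases h with rfl | rfl | rfl | rfl <;> simp <;> omega

theorem edge_comm {u w : ℤ × ℤ} (h : Adj u w) : edge u w = edge w u := by
  obtain ⟨x, y⟩ := u
  rcases h with rfl | rfl | rfl | rfl <;> simp

theorem ends_edge {u w : ℤ × ℤ} (h : Adj u w) : ends (edge u w) = {u, w} := by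
  obtain ⟨x, y⟩ := u
  rcases h with rfl | rfl | rfl | rfl <;> simp [ends, Set.pair_comm]

theorem exists_edge_of_mem_ends {s : Stitch} {u : ℤ × ℤ} (h : u ∈ ends s) :
    ∃ w, Adj u w ∧ s = edge u w := by
  cases s with
  | vert x y =>
    rcases h with rfl | rfl
    · exact ⟨(x, y + 1), by simp [Adj], by simp⟩
    · exact ⟨(x, y), by simp [Adj], by simp⟩
  | horiz x y =>
    rcases h with rfl | rfl
    · exact ⟨(x + 1, y), by simp [Adj], by simp⟩
    · exact ⟨(x, y), by simp [Adj], by simp⟩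

theorem TwoRegular.exists_two {T : Set Stitch} (hT : TwoRegular T) {s : Stitch} (hs : s ∈ T)
    {u : ℤ × ℤ} (hu : u ∈ ends s) :
    ∃ w w', w ≠ w' ∧ Adj u w ∧ Adj u w' ∧ edge u w ∈ T ∧ edge u w' ∈ T := by
  obtain ⟨w, hw, rfl⟩ := exists_edge_of_mem_ends hu
  suffices ∃ w', w ≠ w' ∧ Adj u w' ∧ edge u w' ∈ T by
    obtain ⟨w', h1, h2, h3⟩ := this
    exact ⟨w, w', h1, hw, h2, hs, h3⟩
  obtain ⟨x, y⟩ := u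
  have := hT x y
  by_contra! hcon
  have e := hcon (x + 1, y)
  have n := hcon (x, y + 1)
  have o := hcon (x - 1, y)
  have z := hcon (x, y - 1)
  rcases hw with rfl | rfl | rfl | rfl <;> simp [Adj] at * <;> grind

theorem TwoRegular.eq_or_eq {T : Set Stitch} (hT : TwoRegular T) {u w w' v : ℤ × ℤ}
    (hne : w ≠ w') (hw : Adj u w) (hw' : Adj u w') (hv : Adj u v) (hwT : edge u w ∈ T)
    (hwT' : edge u w' ∈ T) (hvT : edge u v ∈ T) : v = w ∨ v = w' := by
  obtain ⟨x, y⟩ := u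
  have := hT x y
  by_contra! hcon
  rcases hw with rfl | rfl | rfl | rfl <;> rcases hw' with rfl | rfl | rfl | rfl <;>
    rcases hv with rfl | rfl | rfl | rfl <;> simp at * <;> tauto

/-- Two cells sharing an edge that is not in `T`. -/
def Step (T : Set Stitch) (c c' : ℤ × ℤ) : Prop :=
  (c' = (c.1 + 1, c.2) ∧ Stitch.vert (c.1 + 1) c.2 ∉ T) ∨
  (c' = (c.1, c.2 + 1) ∧ Stitch.horiz c.1 (c.2 + 1) ∉ T)

/-- Two cells joined by a chain of cells that crosses no stitch of `T`. -/
def Reach (T : Set Stitch) (c c' : ℤ × ℤ) : Prop :=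
  Quot.mk (Step T) c = Quot.mk (Step T) c'

theorem Reach.map_eq {T : Set Stitch} {α : Type*} {f : ℤ × ℤ → α}
    (hf : ∀ c c', Step T c c' → f c = f c') {c c' : ℤ × ℤ} (h : Reach T c c') : f c = f c' :=
  congrArg (Quot.lift f hf) h

theorem reach_of_vert_notMem {T : Set Stitch} {x y : ℤ} (h : Stitch.vert x y ∉ T) :
    Reach T (x - 1, y) (x, y) :=
  Quot.sound (Or.inl (by simpa using h))

theorem reach_of_horiz_notMem {T : Set Stitch} {x y : ℤ} (h : Stitch.horiz x y ∉ T) :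
    Reach T (x, y - 1) (x, y) :=
  Quot.sound (Or.inr (by simpa using h))

theorem TwoRegular.reach_left {T : Set Stitch} (hT : TwoRegular T) {x u w : ℤ × ℤ}
    (hxu : Adj x u) (huw : Adj u w) (hne : x ≠ w) (hx : edge x u ∈ T) (hw : edge u w ∈ T) :
    Reach T (left x u) (left u w) := by
  obtain ⟨a, b⟩ := u
  have h0 := hT a b
  have hN : Stitch.vert a b ∉ T → _ := reach_of_vert_notMem
  have hS : Stitch.vert a (b - 1) ∉ T → _ := reach_of_vert_notMem
  have hE : Stitch.horiz a b ∉ T → _ := reach_of_horiz_notMem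
  have hW : Stitch.horiz (a - 1) b ∉ T → _ := reach_of_horiz_notMem
  have hux := hxu.symm
  unfold Reach at *
  rcases hux with rfl | rfl | rfl | rfl <;> rcases huw with rfl | rfl | rfl | rfl <;>
    simp at * <;> grind

open Classical in
/-- The indicator of membership of a stitch, as an element of `ZMod 2`. -/
noncomputable def ind (T : Set Stitch) (s : Stitch) : ZMod 2 := if s ∈ T then 1 else 0

/-- `P` is the parity of the number of times a ray from a cell to infinity crosses `T`. -/
structure IsParity (T : Set Stitch) (P : ℤ × ℤ → ZMod 2) : Prop where
  horiz : ∀ x y, P (x, y - 1) = P (x, y) + ind T (.horiz x y)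
  vert : ∀ x y, P (x - 1, y) = P (x, y) + ind T (.vert x y)
  finite : {c | P c ≠ 0}.Finite

theorem exists_bound {T : Set Stitch} (hT : T.Finite) : ∃ N : ℤ, 0 < N ∧
    (∀ x y, Stitch.vert x y ∈ T → |x| < N ∧ |y| < N) ∧
    (∀ x y, Stitch.horiz x y ∈ T → |x| < N ∧ |y| < N) := by
  induction T, hT using Set.Finite.induction_on with
  | empty => exact ⟨1, by simp⟩
  | @insert s T _ _ ih =>
    obtain ⟨N, h0, h1, h2⟩ := ih
    cases s with
    | vert a b =>
      refine ⟨max N (max (|a| + 1) (|b| + 1)), by simp [h0], fun x y h ↦ ?_, fun x y h ↦ ?_⟩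
      · rcases h with h | h
        · cases h; simp
        · simp [h1 x y h]
      · rcases h with h | h
        · cases h
        · simp [h2 x y h]
    | horiz a b =>
      refine ⟨max N (max (|a| + 1) (|b| + 1)), by simp [h0], fun x y h ↦ ?_, fun x y h ↦ ?_⟩
      · rcases h with h | h
        · cases h
        · simp [h1 x y h]
      · rcases h with h | h
        · cases h; simp
        · simp [h2 x y h]

theorem zmod_two_add_self (a : ZMod 2) : a + a = 0 := CharTwo.add_self_eq_zero a

theorem TwoRegular.exists_isParity {T : Set Stitch} (hT : TwoRegular T) (hfin : T.Finite) :
    ∃ P, IsParity T P := by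
  obtain ⟨N, h0, hv, hh⟩ := exists_bound hfin
  have hv' : ∀ x y, N ≤ |x| ∨ N ≤ |y| → ind T (.vert x y) = 0 := by
    intro x y h
    refine if_neg fun h1 ↦ ?_
    have := hv x y h1
    omega
  have hh' : ∀ x y, N ≤ |x| ∨ N ≤ |y| → ind T (.horiz x y) = 0 := by
    intro x y h
    refine if_neg fun h1 ↦ ?_
    have := hh x y h1
    omega
  have hdeg : ∀ x y, ind T (.vert x (y - 1)) =
      ind T (.vert x y) + ind T (.horiz x y) + ind T (.horiz (x - 1) y) := by
    intro x y
    have := (hT x y).1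
    unfold ind
    split_ifs <;> first | decide | tauto
  let P : ℤ × ℤ → ZMod 2 := fun c ↦ ∑ y ∈ Finset.Ioc c.2 N, ind T (.horiz c.1 y)
  have hPtop : ∀ x y, N ≤ y → P (x, y) = 0 := by
    intro x y hy
    simp [P, Finset.Ioc_eq_empty_of_le hy]
  have hPx : ∀ x y, N ≤ |x| → P (x, y) = 0 := fun x y hx ↦
    Finset.sum_eq_zero fun z _ ↦ hh' x z (Or.inl hx)
  have hPh : ∀ x y, P (x, y - 1) = P (x, y) + ind T (.horiz x y) := by
    intro x y
    by_cases hy : y ≤ N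
    · have : Finset.Ioc (y - 1) N = insert y (Finset.Ioc y N) := by
        ext z; simp only [Finset.mem_Ioc, Finset.mem_insert]; omega
      simp only [P, this]
      rw [Finset.sum_insert (by simp), add_comm]
    · rw [hPtop x y (by omega), hPtop x (y - 1) (by omega), hh' x y (Or.inr ?_), add_zero]
      exact le_trans (by omega) (le_abs_self y)
  have hPv : ∀ x y, P (x - 1, y) = P (x, y) + ind T (.vert x y) := by
    intro x y
    rcases le_total N y with hy | hy
    · rw [hPtop _ _ hy, hPtop _ _ hy, hv' x y (Or.inr (hy.trans (le_abs_self y))), add_zero]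
    · induction y, hy using Int.leInductionDown with
      | base =>
        rw [hPtop _ _ le_rfl, hPtop _ _ le_rfl, hv' x N (Or.inr (le_abs_self N)), add_zero]
      | pred y _ ih =>
        rw [hPh, hPh, ih, hdeg]
        linear_combination -zmod_two_add_self (ind T (.horiz x y))
  have hPbot : ∀ x y, y ≤ -N → P (x, y) = 0 := by
    intro x y hy
    have hstep : ∀ x, P (x - 1, y) = P (x, y) := fun x ↦ by
      rw [hPv, hv' x y (Or.inr (le_trans (by omega) (neg_le_abs y))), add_zero]
    rcases le_total N x with hx | hx
    · exact hPx x y (hx.trans (le_abs_self x))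
    · induction x, hx using Int.leInductionDown with
      | base => exact hPx N y (le_abs_self N)
      | pred x _ ih => rw [hstep, ih]
  refine ⟨P, hPh, hPv, Set.Finite.subset
    ((Set.finite_Icc (-N) N).prod (Set.finite_Icc (-N) N)) ?_⟩
  rintro ⟨x, y⟩ hP
  have h1 : ¬ N ≤ |x| := fun h ↦ hP (hPx x y h)
  have h2 : ¬ N ≤ y := fun h ↦ hP (hPtop x y h)
  have h3 : ¬ y ≤ -N := fun h ↦ hP (hPbot x y h)
  rw [not_le, abs_lt] at h1
  simp only [Set.mem_prod, Set.mem_Icc]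
  omega

theorem exists_horiz_above {T : Set Stitch} {P : ℤ × ℤ → ZMod 2}
    (hP : ∀ x y, P (x, y - 1) = P (x, y) + ind T (.horiz x y)) (hfin : {c | P c ≠ 0}.Finite)
    {x y : ℤ} (hxy : P (x, y) ≠ 0) : ∃ z > y, Stitch.horiz x z ∈ T := by
  by_contra! hcon
  refine Set.infinite_of_injective_forall_mem (f := fun n : ℕ ↦ (x, y + n))
    (fun a b hab ↦ by simpa using hab) (fun n ↦ ?_) hfin
  induction n with
  | zero => simpa using hxy
  | succ n ih =>
    have := hP x (y + (n + 1 : ℕ))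
    rw [ind, if_neg (hcon _ (by omega)), add_zero,
      show y + ((n + 1 : ℕ) : ℤ) - 1 = y + n by omega] at this
    rwa [Set.mem_ofPred_eq, ← this]

namespace IsParity
variable {T : Set Stitch} {P : ℤ × ℤ → ZMod 2} (hP : IsParity T P)
include hP

theorem eq_of_reach {c c' : ℤ × ℤ} (h : Reach T c c') : P c = P c' := by
  refine h.map_eq ?_
  rintro ⟨x, y⟩ c' (⟨rfl, h⟩ | ⟨rfl, h⟩)
  · simpa [ind, h] using hP.vert (x + 1) y
  · simpa [ind, h] using hP.horiz x (y + 1)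

theorem left_eq {u w : ℤ × ℤ} (h : Adj u w) (hT : edge u w ∈ T) :
    P (left u w) = P (left w u) + 1 := by
  obtain ⟨x, y⟩ := u
  have h1 := hP.vert x y
  have h2 := hP.vert x (y - 1)
  have h3 := hP.horiz x y
  have h4 := hP.horiz (x - 1) y
  unfold ind at *
  have key : ∀ a : ZMod 2, a + 1 + 1 = a := by decide
  rcases h with rfl | rfl | rfl | rfl <;> simp_all

end IsParity

/-- `T` is a union of connected components of the graph with edge set `S`. -/
def Isolated (T S : Set Stitch) : Prop :=
  T ⊆ S ∧ ∀ s ∈ S, ∀ t ∈ T, ∀ u ∈ ends s, u ∈ ends t → s ∈ T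

theorem Isolated.twoRegular {T S : Set Stitch} (h : Isolated T S) (hS : TwoRegular S) :
    TwoRegular T := by
  intro x y
  have h0 := hS x y
  have key : ∀ s t, (x, y) ∈ ends s → (x, y) ∈ ends t → s ∈ S → t ∈ T → s ∈ T :=
    fun s t hs ht hsS htT ↦ h.2 s hsS t htT _ hs ht
  have hN : (x, y) ∈ ends (.vert x y) := by simp [ends]
  have hD : (x, y) ∈ ends (.vert x (y - 1)) := by simp [ends]
  have hE : (x, y) ∈ ends (.horiz x y) := by simp [ends]
  have hW : (x, y) ∈ ends (.horiz (x - 1) y) := by simp [ends]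
  by_cases hex : ∃ t ∈ T, (x, y) ∈ ends t
  · obtain ⟨t, ht, hxt⟩ := hex
    have e : ∀ s, (x, y) ∈ ends s → (s ∈ T ↔ s ∈ S) := fun s hs ↦
      ⟨fun h1 ↦ h.1 h1, fun h1 ↦ key s t hs hxt h1 ht⟩
    rwa [e _ hN, e _ hD, e _ hE, e _ hW]
  · have e : ∀ s, (x, y) ∈ ends s → s ∉ T := fun s hs h1 ↦ hex ⟨s, h1, hs⟩
    simp [e _ hN, e _ hD, e _ hE, e _ hW]

/-- The stitches of `T` form the simple closed grid walk `γ 0, γ 1, …, γ n = γ 0`. -/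
structure IsLoop (T : Set Stitch) (n : ℕ) (γ : ℕ → ℤ × ℤ) : Prop where
  three_le : 3 ≤ n
  injOn : Set.InjOn γ (Set.Iio n)
  closed : γ n = γ 0
  adj : ∀ i < n, Adj (γ i) (γ (i + 1))
  mem_iff : ∀ s, s ∈ T ↔ ∃ i < n, s = edge (γ i) (γ (i + 1))

namespace IsLoop
variable {T : Set Stitch} {n : ℕ} {γ : ℕ → ℤ × ℤ} (h : IsLoop T n γ)
include h

theorem edge_mem {i : ℕ} (hi : i < n) : edge (γ i) (γ (i + 1)) ∈ T :=
  (h.mem_iff _).2 ⟨i, hi, rfl⟩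

theorem finite : T.Finite := by
  refine ((Set.finite_Iio n).image fun i ↦ edge (γ i) (γ (i + 1))).subset fun s hs ↦ ?_
  obtain ⟨i, hi, rfl⟩ := (h.mem_iff s).1 hs
  exact ⟨i, hi, rfl⟩

theorem exists_eq_of_le {i : ℕ} (hi : i ≤ n) : ∃ t < n, γ i = γ t := by
  rcases hi.lt_or_eq with hi | rfl
  · exact ⟨i, hi, rfl⟩
  · exact ⟨0, by have := h.three_le; omega, h.closed⟩

theorem exists_of_mem_ends {s : Stitch} (hs : s ∈ T) {u : ℤ × ℤ} (hu : u ∈ ends s) :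
    ∃ i < n, u = γ i := by
  obtain ⟨i, hi, rfl⟩ := (h.mem_iff s).1 hs
  rw [ends_edge (h.adj i hi)] at hu
  rcases hu with rfl | rfl
  · exact ⟨i, hi, rfl⟩
  · exact h.exists_eq_of_le hi

theorem ne_add_two {i : ℕ} (hi : i + 1 < n) : γ i ≠ γ (i + 2) := by
  have h3 := h.three_le
  rcases (show i + 2 ≤ n from hi).lt_or_eq with h1 | h1
  · intro he
    have := h.injOn (show i < n by omega) h1 he
    omega
  · rw [h1, h.closed]
    intro he
    have := h.injOn (show i < n by omega) (show 0 < n by omega) he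
    omega

theorem exists_two {i : ℕ} (hi : i < n) : ∃ w w', w ≠ w' ∧ Adj (γ i) w ∧ Adj (γ i) w' ∧
    edge (γ i) w ∈ T ∧ edge (γ i) w' ∈ T := by
  have h3 := h.three_le
  rcases Nat.eq_zero_or_pos i with rfl | h0
  · have hn : n - 1 + 1 = n := by omega
    have ha := h.adj (n - 1) (by omega)
    have he := h.edge_mem (show n - 1 < n by omega)
    rw [hn, h.closed] at ha he
    refine ⟨γ 1, γ (n - 1), fun h1 ↦ ?_, h.adj 0 hi, ha.symm, h.edge_mem hi, ?_⟩
    · have := h.injOn (show 1 < n by omega) (show n - 1 < n by omega) h1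
      omega
    · rwa [edge_comm ha.symm]
  · obtain ⟨i, rfl⟩ := Nat.exists_eq_add_of_le' h0
    have ha := h.adj i (by omega)
    refine ⟨γ i, γ (i + 2), h.ne_add_two hi, ha.symm, h.adj _ hi, ?_, h.edge_mem hi⟩
    rw [edge_comm ha.symm]
    exact h.edge_mem (by omega)

theorem isolated {S : Set Stitch} (hTS : T ⊆ S) (hS : TwoRegular S) : Isolated T S := by
  refine ⟨hTS, fun s hs t ht u hu hut ↦ ?_⟩
  obtain ⟨i, hi, rfl⟩ := h.exists_of_mem_ends ht hut
  obtain ⟨w, w', hne, hw, hw', hwT, hwT'⟩ := h.exists_two hi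
  obtain ⟨v, hv, rfl⟩ := exists_edge_of_mem_ends hu
  rcases hS.eq_or_eq hne hw hw' hv (hTS hwT) (hTS hwT') hs with rfl | rfl <;> assumption

theorem reach_left (hT : TwoRegular T) {i : ℕ} (hi : i < n) :
    Reach T (left (γ 0) (γ 1)) (left (γ i) (γ (i + 1))) := by
  induction i with
  | zero => exact rfl
  | succ i ih =>
    exact (ih (by omega)).trans (hT.reach_left (h.adj i (by omega)) (h.adj _ hi) (h.ne_add_two hi)
      (h.edge_mem (by omega)) (h.edge_mem hi))

theorem reach_right (hT : TwoRegular T) {i : ℕ} (hi : i < n) :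
    Reach T (left (γ 1) (γ 0)) (left (γ (i + 1)) (γ i)) := by
  induction i with
  | zero => exact rfl
  | succ i ih =>
    have h1 := h.adj i (by omega)
    have h2 := h.adj _ hi
    refine (ih (by omega)).trans (Eq.symm (hT.reach_left h2.symm h1.symm (h.ne_add_two hi).symm
      ?_ ?_))
    · rw [edge_comm h2.symm]; exact h.edge_mem hi
    · rw [edge_comm h1.symm]; exact h.edge_mem (by omega)

/-- Cells of equal parity on the two sides of edges of a loop are joined off the loop. -/
theorem reach_of_sides (hT : TwoRegular T) {P : ℤ × ℤ → ZMod 2} (hP : IsParity T P)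
    {u w u' w' : ℤ × ℤ} (ha : Adj u w) (ha' : Adj u' w') (he : edge u w ∈ T)
    (he' : edge u' w' ∈ T) (hPP : P (left u w) = P (left u' w')) :
    Reach T (left u w) (left u' w') := by
  have key : ∀ u w, Adj u w → edge u w ∈ T →
      Reach T (left (γ 0) (γ 1)) (left u w) ∨ Reach T (left (γ 1) (γ 0)) (left u w) := by
    intro u w ha he
    obtain ⟨i, hi, hiT⟩ := (h.mem_iff _).1 he
    have hends := ends_edge ha
    rw [hiT, ends_edge (h.adj i hi)] at hends
    rcases Set.pair_eq_pair_iff.1 hends with ⟨rfl, rfl⟩ | ⟨rfl, rfl⟩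
    · exact Or.inl (h.reach_left hT hi)
    · exact Or.inr (h.reach_right hT hi)
  have h0 : 0 < n := by have := h.three_le; omega
  have hlr := hP.left_eq (h.adj 0 h0) (h.edge_mem h0)
  have h01 : ∀ a : ZMod 2, a + 1 ≠ a := by decide
  rcases key u w ha he with k1 | k1 <;> rcases key u' w' ha' he' with k2 | k2
  · exact k1.symm.trans k2
  · rw [← hP.eq_of_reach k1, ← hP.eq_of_reach k2, hlr] at hPP
    exact absurd hPP (h01 _)
  · rw [← hP.eq_of_reach k1, ← hP.eq_of_reach k2, hlr] at hPP
    exact absurd hPP.symm (h01 _)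
  · exact k1.symm.trans k2

/-- An even cell is joined to infinity off the loop. -/
theorem exists_reach_up (hT : TwoRegular T) {P : ℤ × ℤ → ZMod 2} (hP : IsParity T P)
    {c : ℤ × ℤ} (hc : P c = 0) : ∃ N, ∀ y ≥ N, Reach T c (c.1, y) := by
  obtain ⟨N, h0, -, hh⟩ := exists_bound h.finite
  obtain ⟨x, j⟩ := c
  have hfree : ∀ y, N ≤ y → Stitch.horiz x y ∉ T := fun y hy hm ↦ by
    have := (abs_lt.1 (hh x y hm).2).2
    omega
  have up : ∀ y, (∀ z > y, Stitch.horiz x z ∉ T) → ∀ z ≥ y, Reach T (x, y) (x, z) := by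
    intro y hy z hz
    induction z, hz using Int.leInduction with
    | base => exact rfl
    | succ z hz ih =>
      have := reach_of_horiz_notMem (hy (z + 1) (by omega))
      rw [add_sub_cancel_right] at this
      exact ih.trans this
  have upN := up N fun z hz ↦ hfree z (by omega)
  suffices ∀ j, P (x, j) = 0 → Reach T (x, j) (x, N) from
    ⟨N, fun y hy ↦ (this j hc).trans (upN y hy)⟩
  intro j hj
  rcases le_total N j with hN | hN
  · exact (upN j hN).symm
  induction j, hN using Int.leInductionDown with
  | base => exact rfl
  | pred j hjN ih =>
    by_cases hm : Stitch.horiz x j ∈ T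
    · obtain ⟨m, ⟨hmT, -⟩, hmax⟩ := Int.exists_greatest_of_bdd
        (P := fun y ↦ Stitch.horiz x y ∈ T ∧ j ≤ y) ⟨N, fun y hy ↦ by
          by_contra hlt
          exact hfree y (by omega) hy.1⟩ ⟨j, hm, le_rfl⟩
      have hreach : Reach T (x, m) (x, N) := up m
        (fun z hz hzT ↦ by
          by_cases hjz : j ≤ z
          · have := hmax z ⟨hzT, hjz⟩; omega
          · have := hmax j ⟨hm, le_rfl⟩; omega) N
        (by by_contra hlt; exact hfree m (by omega) hmT)
      have hPN : P (x, N) = 0 := by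
        by_contra hne
        obtain ⟨z, hz, hzT⟩ := exists_horiz_above hP.horiz hP.finite hne
        exact hfree z hz.le hzT
      refine Eq.trans ?_ hreach
      have := h.reach_of_sides hT hP (u := (x + 1, j)) (w := (x, j)) (u' := (x, m))
        (w' := (x + 1, m)) (by simp [Adj]) (by simp [Adj]) (by simpa) (by simpa)
      simp only [left_west', left_east] at this
      exact this (by rw [hj, hP.eq_of_reach hreach, hPN])
    · have := reach_of_horiz_notMem hm
      exact Eq.trans this (ih (by rw [← hP.eq_of_reach this, hj]))

end IsLoop

/-- The directed edge from `u` to `w` lies in `C` and has an odd cell on its left. -/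
def Out (C : Set Stitch) (P : ℤ × ℤ → ZMod 2) (u w : ℤ × ℤ) : Prop :=
  Adj u w ∧ edge u w ∈ C ∧ P (left u w) = 1

section
variable {C : Set Stitch} {P : ℤ × ℤ → ZMod 2} (hC : TwoRegular C) (hP : IsParity C P)
include hC hP

theorem Out.right_unique {u w w' : ℤ × ℤ} (h : Out C P u w) (h' : Out C P u w') : w = w' := by
  obtain ⟨ha, he, hl⟩ := h
  obtain ⟨ha', he', hl'⟩ := h'
  by_contra hne
  have hr := hP.eq_of_reach (hC.reach_left ha.symm ha' hne (by rwa [edge_comm ha.symm]) he')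
  have := hP.left_eq ha he
  rw [hr, hl, hl'] at this
  exact absurd this (by decide)

theorem Out.left_unique {u w w' : ℤ × ℤ} (h : Out C P w u) (h' : Out C P w' u) : w = w' := by
  obtain ⟨ha, he, hl⟩ := h
  obtain ⟨ha', he', hl'⟩ := h'
  by_contra hne
  have hr := hP.eq_of_reach (hC.reach_left ha ha'.symm hne he (by rwa [edge_comm ha'.symm]))
  have := hP.left_eq ha' he'
  rw [← hr, hl, hl'] at this
  exact absurd this (by decide)

omit hC in
theorem Out.asymm {u w : ℤ × ℤ} (h : Out C P u w) (h' : Out C P w u) : False := by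
  have := hP.left_eq h.1 h.2.1
  rw [h.2.2, h'.2.2] at this
  exact absurd this (by decide)

theorem exists_out {s : Stitch} (hs : s ∈ C) {u : ℤ × ℤ} (hu : u ∈ ends s) :
    ∃ w, Out C P u w := by
  obtain ⟨w, w', hne, ha, ha', he, he'⟩ := hC.exists_two hs hu
  have h01 : ∀ a : ZMod 2, a = 1 ∨ a = 0 := by decide
  rcases h01 (P (left u w)) with hl | hl
  · exact ⟨w, ha, he, hl⟩
  · refine ⟨w', ha', he', ?_⟩
    rw [← hP.eq_of_reach (hC.reach_left ha.symm ha' hne (by rwa [edge_comm ha.symm]) he')]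
    have := hP.left_eq ha he
    rw [hl] at this
    rcases h01 (P (left w u)) with h1 | h1
    · exact h1
    · rw [h1] at this
      exact absurd this (by decide)

/-- Following the boundary with the odd side on the left gives a closed walk. -/
theorem exists_oriented_walk (hfin : C.Finite) {s : Stitch} (hs : s ∈ C) {v : ℤ × ℤ}
    (hv : v ∈ ends s) : ∃ (n : ℕ) (γ : ℕ → ℤ × ℤ), 3 ≤ n ∧ Set.InjOn γ (Set.Iio n) ∧
      γ n = γ 0 ∧ γ 0 = v ∧ ∀ i, Out C P (γ i) (γ (i + 1)) := by
  let V : Set (ℤ × ℤ) := {u | ∃ s ∈ C, u ∈ ends s}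
  have hV : V.Finite := by
    refine (hfin.biUnion (t := ends) fun s _ ↦ ?_).subset fun u hu ↦ by simpa [V] using hu
    cases s <;> simp [ends]
  have hout : ∀ u : V, ∃ w : V, Out C P u w := by
    rintro ⟨u, s, hs, hu⟩
    obtain ⟨w, hw⟩ := exists_out hC hP hs hu
    exact ⟨⟨w, _, hw.2.1, by simp [ends_edge hw.1]⟩, hw⟩
  choose f hf using hout
  have : Finite V := hV
  have hinj : Function.Injective f := fun a b hab ↦
    Subtype.ext (Out.left_unique hC hP (hf a) (hab ▸ hf b))
  let v' : V := ⟨v, s, hs, hv⟩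
  have hper := hinj.mem_periodicPts v'
  have hpos := Function.minimalPeriod_pos_of_mem_periodicPts hper
  have hstep : ∀ i, Out C P (f^[i] v') (f^[i + 1] v') := fun i ↦ by
    rw [Function.iterate_succ_apply']
    exact hf _
  have hclosed : f^[Function.minimalPeriod f v'] v' = v' := Function.isPeriodicPt_minimalPeriod f v'
  refine ⟨Function.minimalPeriod f v', fun i ↦ f^[i] v', ?_, ?_, ?_, rfl, hstep⟩
  · by_contra hlt
    have h12 : Function.minimalPeriod f v' = 1 ∨ Function.minimalPeriod f v' = 2 := by omega
    have h0 := hstep 0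
    have h1 := hstep 1
    rcases h12 with e | e <;> rw [e] at hclosed
    · simp only [zero_add, hclosed] at h0
      exact h0.1.ne rfl
    · simp only [Nat.reduceAdd, hclosed] at h1
      exact Out.asymm hP h0 h1
  · intro a ha b hb hab
    exact Function.iterate_injOn_Iio_minimalPeriod ha hb (Subtype.ext hab)
  · simp [hclosed]

end

/-- The stitches of the walk `γ s, γ (s + 1), …, γ (s + M)`, closed up by one more stitch. -/
def closedArc (γ : ℕ → ℤ × ℤ) (s M : ℕ) : Set Stitch :=
  {t | (∃ i < M, t = edge (γ (s + i)) (γ (s + i + 1))) ∨ t = edge (γ (s + M)) (γ s)}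

theorem IsLoop.closedArc {T : Set Stitch} {n : ℕ} {γ : ℕ → ℤ × ℤ} (h : IsLoop T n γ) {s M : ℕ}
    (hM : 2 ≤ M) (hn : s + M < n) (ha : Adj (γ (s + M)) (γ s)) :
    IsLoop (closedArc γ s M) (M + 1) (fun i ↦ γ (s + i % (M + 1))) := by
  have hmod : ∀ i ≤ M, i % (M + 1) = i := fun i hi ↦ Nat.mod_eq_of_lt (by omega)
  refine ⟨by omega, ?_, by simp, ?_, ?_⟩
  · intro a ha b hb hab
    rw [Set.mem_Iio] at ha hb
    simp only [hmod a (by omega), hmod b (by omega)] at hab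
    have := h.injOn (show s + a < n by omega) (show s + b < n by omega) hab
    omega
  · intro i hi
    rcases (Nat.lt_succ_iff.1 hi).lt_or_eq with h1 | rfl
    · simp only [hmod i (by omega), hmod (i + 1) h1]
      exact h.adj (s + i) (by omega)
    · simpa only [hmod i le_rfl, Nat.mod_self, add_zero] using ha
  · intro t
    constructor
    · rintro (⟨i, hi, rfl⟩ | rfl)
      · exact ⟨i, by omega, by simp only [hmod i (by omega), hmod (i + 1) hi]; rfl⟩
      · exact ⟨M, by omega, by simp only [hmod M le_rfl, Nat.mod_self, add_zero]⟩
    · rintro ⟨i, hi, rfl⟩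
      rcases (Nat.lt_succ_iff.1 hi).lt_or_eq with h1 | rfl
      · exact Or.inl ⟨i, h1, by simp only [hmod i (by omega), hmod (i + 1) h1]; rfl⟩
      · exact Or.inr (by simp only [hmod i le_rfl, Nat.mod_self, add_zero])

/-- No stitch of `T` shares an endpoint with a stitch of `T'`. -/
def VertexDisjoint (T T' : Set Stitch) : Prop := ∀ s ∈ T, ∀ t ∈ T', Disjoint (ends s) (ends t)

theorem VertexDisjoint.symm {T T' : Set Stitch} (h : VertexDisjoint T T') :
    VertexDisjoint T' T := fun s hs t ht ↦ (h t ht s hs).symm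

theorem VertexDisjoint.notMem {T T' : Set Stitch} (h : VertexDisjoint T T') {s t : Stitch}
    {u : ℤ × ℤ} (hs : s ∈ T) (hu : u ∈ ends s) (hut : u ∈ ends t) : t ∉ T' :=
  fun ht ↦ Set.disjoint_left.1 (h s hs t ht) hu hut

/-- The parity with respect to `T'` is constant around and along a loop disjoint from `T'`. -/
theorem IsLoop.parity_const {T T' : Set Stitch} {n : ℕ} {γ : ℕ → ℤ × ℤ} (h : IsLoop T n γ)
    (hd : VertexDisjoint T T') {P : ℤ × ℤ → ZMod 2} (hP : IsParity T' P) {i : ℕ} (hi : i < n) :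
    P (γ i) = P (γ 0) := by
  induction i with
  | zero => rfl
  | succ i ih =>
    rw [← ih (by omega)]
    have ha := h.adj i (by omega)
    have he := h.edge_mem (show i < n by omega)
    have h1 : ∀ t, γ i ∈ ends t → t ∉ T' := fun t ht ↦ hd.notMem he (by simp [ends_edge ha]) ht
    have h2 : ∀ t, γ (i + 1) ∈ ends t → t ∉ T' :=
      fun t ht ↦ hd.notMem he (by simp [ends_edge ha]) ht
    refine hP.eq_of_reach ?_
    generalize γ i = u at *
    generalize γ (i + 1) = w at *
    obtain ⟨x, y⟩ := u
    rcases ha with rfl | rfl | rfl | rfl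
    · have := reach_of_vert_notMem (h2 (.vert (x + 1) y) (by simp [ends]))
      rw [add_sub_cancel_right] at this
      exact this.symm
    · have := reach_of_horiz_notMem (h2 (.horiz x (y + 1)) (by simp [ends]))
      rw [add_sub_cancel_right] at this
      exact this.symm
    · exact reach_of_vert_notMem (h1 (.vert x y) (by simp [ends]))
    · exact reach_of_horiz_notMem (h1 (.horiz x y) (by simp [ends]))

/-- Two disjoint loops cannot be inside each other. -/
theorem IsLoop.not_mutually_inside {T T' : Set Stitch} {n n' : ℕ} {γ γ' : ℕ → ℤ × ℤ}
    (h : IsLoop T n γ) (h' : IsLoop T' n' γ') {P P' : ℤ × ℤ → ZMod 2} (hP : IsParity T P)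
    (hP' : IsParity T' P') (h1 : ∀ i < n, P' (γ i) ≠ 0) (h2 : ∀ i < n', P (γ' i) ≠ 0) : False := by
  have h3 := h.three_le
  obtain ⟨i, hi, hmax⟩ := (Finset.range n).exists_max_image (fun i ↦ (γ i).2) ⟨0, by simp; omega⟩
  rw [Finset.mem_range] at hi
  obtain ⟨z, hz, hzT⟩ := exists_horiz_above hP'.horiz hP'.finite (h1 i hi)
  obtain ⟨i', hi', hu⟩ := h'.exists_of_mem_ends hzT (u := ((γ i).1, z)) (by simp [ends])
  have := h2 i' hi'
  rw [← hu] at this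
  obtain ⟨z', hz', hzT'⟩ := exists_horiz_above hP.horiz hP.finite this
  obtain ⟨l, hl, hul⟩ := h.exists_of_mem_ends hzT' (u := ((γ i).1, z')) (by simp [ends])
  have h4 := hmax l (Finset.mem_range.2 hl)
  simp only [← hul] at h4
  omega

/-- Parity is additive when a loop is cut into two loops along a cell. -/
theorem IsParity.add {T T₁ T₂ : Set Stitch} {P P₁ P₂ : ℤ × ℤ → ZMod 2} (hP : IsParity T P)
    (hP₁ : IsParity T₁ P₁) (hP₂ : IsParity T₂ P₂) {k j : ℤ}
    (hT : ∀ x y, ind T (.horiz x y) = ind T₁ (.horiz x y) + ind T₂ (.horiz x y) +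
      (if x = k ∧ (y = j ∨ y = j + 1) then 1 else 0)) (c : ℤ × ℤ) :
    P c = P₁ c + P₂ c + if c = (k, j) then 1 else 0 := by
  let D : ℤ × ℤ → ZMod 2 := fun c ↦ P c + (P₁ c + P₂ c + if c = (k, j) then 1 else 0)
  have hfin : {c | D c ≠ 0}.Finite := by
    refine (((hP.finite.union hP₁.finite).union hP₂.finite).union
      (Set.finite_singleton (k, j))).subset fun c hc ↦ ?_
    by_contra hcon
    simp only [Set.mem_union, Set.mem_ofPred_eq, Set.mem_singleton_iff, not_or, not_not] at hcon
    obtain ⟨⟨⟨h1, h2⟩, h3⟩, h4⟩ := hcon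
    exact hc (by simp [D, h1, h2, h3, h4])
  have hD : ∀ x y, D (x, y - 1) = D (x, y) + ind ∅ (.horiz x y) := by
    intro x y
    simp only [D, hP.horiz, hP₁.horiz, hP₂.horiz, hT, Prod.mk.injEq]
    have hcell : (if x = k ∧ y - 1 = j then (1 : ZMod 2) else 0) = (if x = k ∧ y = j then 1 else 0)
        + if x = k ∧ (y = j ∨ y = j + 1) then 1 else 0 := by
      by_cases hx : x = k
      · by_cases hy : y = j
        · simp [hx, hy, zmod_two_add_self]
        · have : y - 1 = j ↔ y = j + 1 := by omega
          simp [hx, hy, this]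
      · simp [hx]
    have hind : ind ∅ (.horiz x y) = 0 := by simp [ind]
    rw [hcell, hind]
    linear_combination zmod_two_add_self
      (ind T₁ (.horiz x y) + ind T₂ (.horiz x y) + if x = k ∧ (y = j ∨ y = j + 1) then 1 else 0)
  have h0 : D c = 0 := by
    by_contra hne
    obtain ⟨z, -, hz⟩ := exists_horiz_above hD hfin hne
    exact hz
  exact CharTwo.add_eq_zero.1 h0

open Set Topology

/-- A grid vertex as a point of the plane. -/
def toPt (u : ℤ × ℤ) : ℝ × ℝ := (u.1, u.2)

theorem toPt_injective : Function.Injective toPt := fun u w h ↦ by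
  simpa [toPt, Prod.ext_iff] using h

theorem mem_seg_vert {a b : ℤ} {p : ℝ × ℝ} :
    p ∈ (Stitch.vert a b).seg ↔ p.1 = a ∧ (b : ℝ) ≤ p.2 ∧ p.2 ≤ b + 1 := by
  obtain ⟨x, y⟩ := p
  rw [Stitch.seg, ← Prod.image_mk_segment_right, segment_eq_Icc (by linarith)]
  simp only [mem_image, mem_Icc, Prod.mk.injEq]
  grind

theorem mem_seg_horiz {a b : ℤ} {p : ℝ × ℝ} :
    p ∈ (Stitch.horiz a b).seg ↔ p.2 = b ∧ (a : ℝ) ≤ p.1 ∧ p.1 ≤ a + 1 := by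
  obtain ⟨x, y⟩ := p
  rw [Stitch.seg, ← Prod.image_mk_segment_left, segment_eq_Icc (by linarith)]
  simp only [mem_image, mem_Icc, Prod.mk.injEq]
  grind

theorem seg_edge {u w : ℤ × ℤ} (h : Adj u w) : (edge u w).seg = segment ℝ (toPt u) (toPt w) := by
  obtain ⟨x, y⟩ := u
  rcases h with rfl | rfl | rfl | rfl
  · simp [Stitch.seg, toPt]
  · simp [Stitch.seg, toPt]
  · rw [segment_symm]; simp [Stitch.seg, toPt]
  · rw [segment_symm]; simp [Stitch.seg, toPt]

theorem toPt_mem_seg {u : ℤ × ℤ} {s : Stitch} (h : u ∈ ends s) : toPt u ∈ s.seg := by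
  obtain ⟨w, hw, rfl⟩ := exists_edge_of_mem_ends h
  rw [seg_edge hw]
  exact left_mem_segment ℝ _ _

theorem mem_ends_of_toPt_mem_seg {u : ℤ × ℤ} {s : Stitch} (h : toPt u ∈ s.seg) : u ∈ ends s := by
  obtain ⟨x, y⟩ := u
  cases s with
  | vert a b =>
    obtain ⟨h1, h2, h3⟩ := mem_seg_vert.1 h
    simp only [toPt] at h1 h2 h3
    norm_cast at h1 h2 h3
    simp only [ends, mem_insert_iff, mem_singleton_iff, Prod.mk.injEq]
    omega
  | horiz a b =>
    obtain ⟨h1, h2, h3⟩ := mem_seg_horiz.1 h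
    simp only [toPt] at h1 h2 h3
    norm_cast at h1 h2 h3
    simp only [ends, mem_insert_iff, mem_singleton_iff, Prod.mk.injEq]
    omega

theorem int_eq_of_mem_Icc {a b : ℤ} {x : ℝ} (hne : a ≠ b) (h1 : (a : ℝ) ≤ x) (h2 : x ≤ a + 1)
    (h3 : (b : ℝ) ≤ x) (h4 : x ≤ b + 1) : (b = a + 1 ∧ x = b) ∨ (a = b + 1 ∧ x = a) := by
  have h5 : a ≤ b + 1 := by exact_mod_cast h1.trans h4
  have h6 : b ≤ a + 1 := by exact_mod_cast h3.trans h2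
  have h7 : b = a + 1 ∨ a = b + 1 := by omega
  rcases h7 with rfl | rfl
  · left; push_cast at *; exact ⟨rfl, by linarith⟩
  · right; push_cast at *; exact ⟨rfl, by linarith⟩

/-- Distinct stitches meet only in a common endpoint. -/
theorem exists_of_mem_seg_of_mem_seg {s t : Stitch} (hne : s ≠ t) {p : ℝ × ℝ} (hs : p ∈ s.seg)
    (ht : p ∈ t.seg) : ∃ u ∈ ends s, u ∈ ends t ∧ p = toPt u := by
  suffices ∃ u, p = toPt u by
    obtain ⟨u, rfl⟩ := this
    exact ⟨u, mem_ends_of_toPt_mem_seg hs, mem_ends_of_toPt_mem_seg ht, rfl⟩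
  obtain ⟨x, y⟩ := p
  cases s with
  | vert a b =>
    obtain ⟨h1, h2, h3⟩ := mem_seg_vert.1 hs
    cases t with
    | vert a' b' =>
      obtain ⟨h1', h2', h3'⟩ := mem_seg_vert.1 ht
      obtain rfl : a = a' := by exact_mod_cast h1.symm.trans h1'
      rcases int_eq_of_mem_Icc (by grind) h2 h3 h2' h3' with ⟨-, h⟩ | ⟨-, h⟩
      · exact ⟨(a, b'), Prod.ext h1 h⟩
      · exact ⟨(a, b), Prod.ext h1 h⟩
    | horiz a' b' =>
      obtain ⟨h1', h2', h3'⟩ := mem_seg_horiz.1 ht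
      exact ⟨(a, b'), Prod.ext h1 h1'⟩
  | horiz a b =>
    obtain ⟨h1, h2, h3⟩ := mem_seg_horiz.1 hs
    cases t with
    | vert a' b' =>
      obtain ⟨h1', h2', h3'⟩ := mem_seg_vert.1 ht
      exact ⟨(a', b), Prod.ext h1' h1⟩
    | horiz a' b' =>
      obtain ⟨h1', h2', h3'⟩ := mem_seg_horiz.1 ht
      obtain rfl : b = b' := by exact_mod_cast h1.symm.trans h1'
      rcases int_eq_of_mem_Icc (by grind) h2 h3 h2' h3' with ⟨-, h⟩ | ⟨-, h⟩
      · exact ⟨(a', b), Prod.ext h h1⟩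
      · exact ⟨(a, b), Prod.ext h h1⟩

theorem mem_curveOf {S : Set Stitch} {p : ℝ × ℝ} : p ∈ curveOf S ↔ ∃ s ∈ S, p ∈ s.seg := by
  simp [curveOf]

theorem seg_subset_curveOf {S : Set Stitch} {s : Stitch} (h : s ∈ S) : s.seg ⊆ curveOf S :=
  fun _ hp ↦ mem_curveOf.2 ⟨s, h, hp⟩

theorem mem_of_seg_subset_curveOf {S : Set Stitch} {s : Stitch} (h : s.seg ⊆ curveOf S) :
    s ∈ S := by
  have : ∃ p ∈ s.seg, ∀ u, p ≠ toPt u := by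
    have h2 : ∀ a b : ℤ, (a : ℝ) + 1 / 2 ≠ b := fun a b h ↦ by
      have h1 : ((2 * a + 1 : ℤ) : ℝ) = (2 * b : ℤ) := by push_cast; linarith
      have := Int.cast_injective h1
      omega
    cases s with
    | vert a b =>
      exact ⟨(a, b + 1 / 2), mem_seg_vert.2 ⟨rfl, by norm_num, by norm_num⟩,
        fun u hu ↦ h2 _ _ (congrArg Prod.snd hu)⟩
    | horiz a b =>
      exact ⟨(a + 1 / 2, b), mem_seg_horiz.2 ⟨rfl, by norm_num, by norm_num⟩,
        fun u hu ↦ h2 _ _ (congrArg Prod.fst hu)⟩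
  obtain ⟨p, hp, hpu⟩ := this
  obtain ⟨t, ht, hpt⟩ := mem_curveOf.1 (h hp)
  by_contra hs
  obtain ⟨u, -, -, hu⟩ := exists_of_mem_seg_of_mem_seg (by rintro rfl; exact hs ht) hp hpt
  exact hpu u hu

theorem isPreconnected_seg (s : Stitch) : IsPreconnected s.seg := by
  cases s <;> exact (convex_segment _ _).isPreconnected

theorem isClosed_seg (s : Stitch) : IsClosed s.seg := by
  cases s with
  | vert a b =>
    have : (Stitch.vert a b).seg = Prod.fst ⁻¹' {(a : ℝ)} ∩ Prod.snd ⁻¹' Icc (b : ℝ) (b + 1) := by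
      ext p; simp [mem_seg_vert]
    rw [this]
    exact (isClosed_singleton.preimage continuous_fst).inter (isClosed_Icc.preimage continuous_snd)
  | horiz a b =>
    have : (Stitch.horiz a b).seg = Prod.snd ⁻¹' {(b : ℝ)} ∩ Prod.fst ⁻¹' Icc (a : ℝ) (a + 1) := by
      ext p; simp [mem_seg_horiz]
    rw [this]
    exact (isClosed_singleton.preimage continuous_snd).inter (isClosed_Icc.preimage continuous_fst)

/-- The closed unit cell with a given southwest corner. -/
def closedCell (c : ℤ × ℤ) : Set (ℝ × ℝ) :=
  Icc (c.1 : ℝ) (c.1 + 1) ×ˢ Icc (c.2 : ℝ) (c.2 + 1)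

theorem mem_floor_window {a : ℤ} {x z : ℝ} (h : |z - x| < 1) (h1 : (a : ℝ) ≤ z)
    (h2 : z ≤ a + 1) : a ∈ Icc (⌊x⌋ - 2) (⌊x⌋ + 2) := by
  have h3 := Int.floor_le x
  have h4 := Int.lt_floor_add_one x
  rw [abs_lt] at h
  constructor
  · have : ((⌊x⌋ - 2 : ℤ) : ℝ) ≤ a := by push_cast; linarith
    exact_mod_cast this
  · have : (a : ℝ) ≤ (⌊x⌋ + 2 : ℤ) := by push_cast; linarith
    exact_mod_cast this

theorem locallyFinite_closedCell : LocallyFinite closedCell := by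
  intro x
  refine ⟨Metric.ball x 1, Metric.ball_mem_nhds x one_pos,
    ((finite_Icc (⌊x.1⌋ - 2) (⌊x.1⌋ + 2)).prod (finite_Icc (⌊x.2⌋ - 2) (⌊x.2⌋ + 2))).subset ?_⟩
  rintro c ⟨p, ⟨⟨h1, h2⟩, h3, h4⟩, hp⟩
  rw [Metric.mem_ball, Prod.dist_eq, max_lt_iff] at hp
  exact ⟨mem_floor_window hp.1 h1 h2, mem_floor_window hp.2 h3 h4⟩

/-- The southwest endpoint of a stitch. -/
def corner : Stitch → ℤ × ℤ
  | .vert a b => (a, b)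
  | .horiz a b => (a, b)

theorem seg_subset_closedCell (s : Stitch) : s.seg ⊆ closedCell (corner s) := by
  intro p hp
  cases s with
  | vert a b =>
    obtain ⟨h1, h2, h3⟩ := mem_seg_vert.1 hp
    exact ⟨⟨h1.ge, by simp [corner, h1]⟩, h2, h3⟩
  | horiz a b =>
    obtain ⟨h1, h2, h3⟩ := mem_seg_horiz.1 hp
    exact ⟨⟨h2, h3⟩, h1.ge, by simp [corner, h1]⟩

theorem locallyFinite_seg : LocallyFinite Stitch.seg := by
  intro x
  obtain ⟨t, ht, hfin⟩ := locallyFinite_closedCell x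
  refine ⟨t, ht, ((hfin.image fun c ↦ Stitch.vert c.1 c.2).union
    (hfin.image fun c ↦ Stitch.horiz c.1 c.2)).subset ?_⟩
  rintro s ⟨p, hp, hpt⟩
  have : (closedCell (corner s) ∩ t).Nonempty := ⟨p, seg_subset_closedCell s hp, hpt⟩
  cases s with
  | vert a b => exact Or.inl ⟨(a, b), this, rfl⟩
  | horiz a b => exact Or.inr ⟨(a, b), this, rfl⟩

theorem isClosed_curveOf (S : Set Stitch) : IsClosed (curveOf S) := by
  rw [curveOf, biUnion_eq_iUnion]
  exact (locallyFinite_seg.comp_injective Subtype.val_injective).isClosed_iUnion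
    fun s ↦ isClosed_seg s

theorem Isolated.connectedComponentIn_eq {T S : Set Stitch} (h : Isolated T S)
    (hc : IsPreconnected (curveOf T)) {p : ℝ × ℝ} (hp : p ∈ curveOf T) :
    connectedComponentIn (curveOf S) p = curveOf T := by
  have hTS : curveOf T ⊆ curveOf S := biUnion_subset_biUnion_left h.1
  refine Subset.antisymm ?_ (hc.subset_connectedComponentIn hp hTS)
  have hdisj : curveOf T ∩ curveOf (S \ T) = ∅ := by
    rw [eq_empty_iff_forall_notMem]
    rintro q ⟨hq, hq'⟩
    obtain ⟨t, ht, hqt⟩ := mem_curveOf.1 hq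
    obtain ⟨s, ⟨hs, hsT⟩, hqs⟩ := mem_curveOf.1 hq'
    obtain ⟨u, hus, hut, -⟩ := exists_of_mem_seg_of_mem_seg (by rintro rfl; exact hsT ht) hqs hqt
    exact hsT (h.2 s hs t ht u hus hut)
  have hcover : connectedComponentIn (curveOf S) p ⊆ curveOf T ∪ curveOf (S \ T) := by
    intro q hq
    obtain ⟨s, hs, hqs⟩ := mem_curveOf.1 (connectedComponentIn_subset _ _ hq)
    by_cases hsT : s ∈ T
    · exact Or.inl (mem_curveOf.2 ⟨s, hsT, hqs⟩)
    · exact Or.inr (mem_curveOf.2 ⟨s, ⟨hs, hsT⟩, hqs⟩)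
  rcases isPreconnected_iff_subset_of_disjoint_closed.1 isPreconnected_connectedComponentIn
    _ _ (isClosed_curveOf _) (isClosed_curveOf _) hcover (by rw [hdisj, inter_empty]) with h1 | h1
  · exact h1
  · have := h1 (mem_connectedComponentIn (hTS hp))
    exact absurd (show p ∈ curveOf T ∩ curveOf (S \ T) from ⟨hp, this⟩) (by simp [hdisj])

/-- A bounded component of a stitch pattern is the union of a finite isolated set of stitches. -/
theorem exists_isolated_finite {S : Set Stitch} {p : ℝ × ℝ}
    (hcomp : IsCompact (connectedComponentIn (curveOf S) p)) :
    {s ∈ S | s.seg ⊆ connectedComponentIn (curveOf S) p}.Finite ∧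
      Isolated {s ∈ S | s.seg ⊆ connectedComponentIn (curveOf S) p} S := by
  refine ⟨(locallyFinite_seg.finite_nonempty_inter_compact hcomp).subset fun s hs ↦ ?_,
    fun s hs ↦ hs.1, fun s hs t ht u hus hut ↦ ⟨hs, ?_⟩⟩
  · have : s.seg.Nonempty := by cases s <;> exact ⟨_, left_mem_segment ℝ _ _⟩
    obtain ⟨q, hq⟩ := this
    exact ⟨q, hq, hs.2 hq⟩
  · rw [connectedComponentIn_eq (ht.2 (toPt_mem_seg hut))]
    exact (isPreconnected_seg s).subset_connectedComponentIn (toPt_mem_seg hus)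
      (seg_subset_curveOf hs)

/-- The supremum-norm circle of the plane is a topological circle. -/
theorem nonempty_circle_homeomorph_sphere :
    Nonempty (Circle ≃ₜ Metric.sphere (0 : ℝ × ℝ) 1) := by
  let e : ℂ → ℝ × ℝ := fun z ↦ (z.re, z.im)
  have he : Continuous e := by fun_prop
  have hinj : Function.Injective e := fun z w h ↦ by
    simpa [e, Complex.ext_iff] using h
  have he0 : ∀ z : Circle, ‖e z‖ ≠ 0 := fun z h ↦ by
    have h1 : (z : ℂ) = 0 := hinj (by rw [norm_eq_zero.1 h]; simp [e]; rfl)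
    exact Circle.coe_ne_zero z h1
  have hsmul : ∀ (r : ℝ) z, e (r * z) = r • e z := fun r z ↦ by simp [e]
  let f : Circle → Metric.sphere (0 : ℝ × ℝ) 1 := fun z ↦
    ⟨‖e z‖⁻¹ • e z, by simp [norm_smul, inv_mul_cancel₀ (he0 z)]⟩
  have hf : Continuous f := by
    refine Continuous.subtype_mk ?_ _
    have : Continuous fun z : Circle ↦ e z := he.comp continuous_subtype_val
    exact (this.norm.inv₀ he0).smul this
  have hbij : Function.Bijective f := by
    constructor
    · intro z w h
      have h1 : ‖e z‖⁻¹ • e z = ‖e w‖⁻¹ • e w := congrArg Subtype.val h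
      rw [← hsmul, ← hsmul] at h1
      have h2 := hinj h1
      have h3 : ‖e z‖⁻¹ = ‖e w‖⁻¹ := by
        have := congrArg norm h2
        simpa only [norm_mul, Circle.norm_coe, mul_one, Complex.norm_real, norm_inv, norm_norm]
          using this
      rw [h3] at h2
      have h4 : ((‖e w‖⁻¹ : ℝ) : ℂ) ≠ 0 := by
        exact_mod_cast inv_ne_zero (he0 w)
      exact Circle.ext (mul_left_cancel₀ h4 h2)
    · rintro ⟨⟨x, y⟩, hxy⟩
      have hn : ‖(x, y)‖ = 1 := by simpa using hxy
      let z : ℂ := ⟨x, y⟩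
      have hz0 : z ≠ 0 := fun h ↦ by
        have h1 : (x, y) = (0 : ℝ × ℝ) := congrArg e h
        rw [h1] at hn
        simp at hn
      have hz1 : ‖z‖ ≠ 0 := norm_ne_zero_iff.2 hz0
      have hmem : ((‖z‖⁻¹ : ℝ) : ℂ) * z ∈ Submonoid.unitSphere ℂ := by
        exact mem_sphere_zero_iff_norm.2 (by simp [inv_mul_cancel₀ hz1])
      refine ⟨⟨_, hmem⟩, Subtype.ext ?_⟩
      change ‖e (((‖z‖⁻¹ : ℝ) : ℂ) * z)‖⁻¹ • e (((‖z‖⁻¹ : ℝ) : ℂ) * z) = (x, y)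
      have hez : e z = (x, y) := rfl
      rw [hsmul, norm_smul, hez, hn, smul_smul]
      simp [hz1]
  exact ⟨hf.homeoOfEquivCompactToT2 (f := Equiv.ofBijective f hbij)⟩

theorem IsLoop.eq_of_edge_eq {T : Set Stitch} {n : ℕ} {γ : ℕ → ℤ × ℤ} (h : IsLoop T n γ)
    {i l : ℕ} (hi : i < n) (hl : l < n) (he : edge (γ i) (γ (i + 1)) = edge (γ l) (γ (l + 1))) :
    i = l := by
  have h3 := h.three_le
  have hends := ends_edge (h.adj i hi)
  rw [he, ends_edge (h.adj l hl)] at hends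
  have key : ∀ i l, i < n → l < n → l < i → γ l = γ (i + 1) → γ (l + 1) = γ i → False := by
    intro i l hi hl hli h1 h2
    have h4 := h.injOn (show l + 1 < n by omega) hi h2
    subst h4
    exact h.ne_add_two hi h1
  rcases Set.pair_eq_pair_iff.1 hends with ⟨h1, -⟩ | ⟨h1, h2⟩
  · exact (h.injOn hl hi h1).symm
  · rcases lt_trichotomy i l with hil | hil | hil
    · exact (key l i hl hi hil h2.symm h1.symm).elim
    · exact hil
    · exact (key i l hi hl hil h1 h2).elim

/-- The closed polygonal path through the vertices of a grid walk. -/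
noncomputable def polygon (γ : ℕ → ℤ × ℤ) (n : ℕ) (t : ℝ) : ℝ × ℝ :=
  toPt (γ 0) + ∑ i ∈ Finset.range n, max 0 (min 1 (t - i)) • (toPt (γ (i + 1)) - toPt (γ i))

theorem continuous_polygon (γ : ℕ → ℤ × ℤ) (n : ℕ) : Continuous (polygon γ n) := by
  unfold polygon
  fun_prop

theorem polygon_apply (γ : ℕ → ℤ × ℤ) {n i : ℕ} (hi : i < n) {s : ℝ} (h0 : 0 ≤ s) (h1 : s ≤ 1) :
    polygon γ n (i + s) = toPt (γ i) + s • (toPt (γ (i + 1)) - toPt (γ i)) := by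
  have hsub : Finset.range (i + 1) ⊆ Finset.range n := Finset.range_subset_range.2 hi
  rw [polygon, ← Finset.sum_subset hsub, Finset.sum_range_succ, add_sub_cancel_left,
    min_eq_right h1, max_eq_right h0, ← add_assoc]
  · congr 1
    rw [Finset.sum_congr rfl (g := fun l ↦ toPt (γ (l + 1)) - toPt (γ l)),
      Finset.sum_range_sub (fun l ↦ toPt (γ l)), add_sub_cancel]
    intro l hl
    have : (l : ℝ) + 1 ≤ i := by exact_mod_cast Finset.mem_range.1 hl
    rw [min_eq_left (by linarith), max_eq_right zero_le_one, one_smul]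
  · intro l _ hl
    have : (i : ℝ) + 1 ≤ l := by exact_mod_cast not_lt.1 fun h ↦ hl (Finset.mem_range.2 h)
    rw [min_eq_right (by linarith), max_eq_left (by linarith), zero_smul]

theorem exists_eq_natCast_add {n : ℕ} {t : ℝ} (ht : t ∈ Ico (0 : ℝ) n) :
    ∃ i < n, ∃ s, 0 ≤ s ∧ s < 1 ∧ t = i + s :=
  ⟨⌊t⌋₊, (Nat.floor_lt ht.1).2 ht.2, t - ⌊t⌋₊, sub_nonneg.2 (Nat.floor_le ht.1),
    by linarith [Nat.lt_floor_add_one t], by ring⟩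

namespace IsLoop
variable {T : Set Stitch} {n : ℕ} {γ : ℕ → ℤ × ℤ} (h : IsLoop T n γ)
include h

theorem polygon_mem_seg {i : ℕ} (hi : i < n) {s : ℝ} (h0 : 0 ≤ s) (h1 : s ≤ 1) :
    polygon γ n (i + s) ∈ (edge (γ i) (γ (i + 1))).seg := by
  rw [polygon_apply γ hi h0 h1, seg_edge (h.adj i hi), segment_eq_image']
  exact ⟨s, ⟨h0, h1⟩, rfl⟩

theorem polygon_zero : polygon γ n 0 = toPt (γ 0) := by
  simpa using polygon_apply γ (show 0 < n by have := h.three_le; omega) le_rfl zero_le_one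

theorem polygon_last : polygon γ n n = toPt (γ 0) := by
  have h3 := h.three_le
  have := polygon_apply γ (show n - 1 < n by omega) zero_le_one le_rfl
  rw [show n - 1 + 1 = n by omega, one_smul, add_sub_cancel, h.closed] at this
  rw [← this]
  congr 1
  push_cast [show 1 ≤ n by omega]
  ring

theorem eq_of_polygon_eq_toPt {i : ℕ} (hi : i < n) {s : ℝ} (h0 : 0 ≤ s) (h1 : s < 1)
    {u : ℤ × ℤ} (hu : polygon γ n (i + s) = toPt u) : u = γ i := by
  have ha := h.adj i hi
  have hne : toPt (γ (i + 1)) - toPt (γ i) ≠ 0 :=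
    sub_ne_zero.2 fun h ↦ ha.ne (toPt_injective h).symm
  have hmem := mem_ends_of_toPt_mem_seg (hu ▸ h.polygon_mem_seg hi h0 h1.le)
  rw [ends_edge ha] at hmem
  rcases hmem with rfl | rfl
  · rfl
  · rw [polygon_apply γ hi h0 h1.le] at hu
    have h2 : (1 - s) • (toPt (γ (i + 1)) - toPt (γ i)) = 0 := by
      rw [sub_smul, one_smul, sub_eq_zero]
      exact sub_eq_iff_eq_add'.2 hu.symm
    rcases smul_eq_zero.1 h2 with h2 | h2
    · linarith
    · exact absurd h2 hne

theorem injOn_polygon : InjOn (polygon γ n) (Ico 0 n) := by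
  intro t ht t' ht' heq
  obtain ⟨i, hi, s, h0, h1, rfl⟩ := exists_eq_natCast_add ht
  obtain ⟨l, hl, r, h0', h1', rfl⟩ := exists_eq_natCast_add ht'
  have hil : i = l := by
    by_contra hil
    obtain ⟨u, -, -, hu⟩ := exists_of_mem_seg_of_mem_seg
      (fun he ↦ hil (h.eq_of_edge_eq hi hl he)) (h.polygon_mem_seg hi h0 h1.le)
      (heq ▸ h.polygon_mem_seg hl h0' h1'.le)
    exact hil (h.injOn hi hl ((h.eq_of_polygon_eq_toPt hi h0 h1 hu).symm.trans
      (h.eq_of_polygon_eq_toPt hl h0' h1' (heq ▸ hu))))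
  subst hil
  rw [polygon_apply γ hi h0 h1.le, polygon_apply γ hi h0' h1'.le] at heq
  have hne : toPt (γ (i + 1)) - toPt (γ i) ≠ 0 :=
    sub_ne_zero.2 fun e ↦ (h.adj i hi).ne (toPt_injective e).symm
  rw [smul_left_injective ℝ hne (add_left_cancel heq)]

theorem image_polygon : polygon γ n '' Ico 0 n = curveOf T := by
  ext p
  constructor
  · rintro ⟨t, ht, rfl⟩
    obtain ⟨i, hi, s, h0, h1, rfl⟩ := exists_eq_natCast_add ht
    exact seg_subset_curveOf (h.edge_mem hi) (h.polygon_mem_seg hi h0 h1.le)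
  · intro hp
    obtain ⟨s, hs, hps⟩ := mem_curveOf.1 hp
    obtain ⟨i, hi, rfl⟩ := (h.mem_iff s).1 hs
    rw [seg_edge (h.adj i hi), segment_eq_image'] at hps
    obtain ⟨s, ⟨h0, h1⟩, rfl⟩ := hps
    simp only [← polygon_apply γ hi h0 h1]
    have hin : (i : ℝ) + 1 ≤ n := by exact_mod_cast hi
    rcases (show (i : ℝ) + s ≤ n by linarith).lt_or_eq with hlt | heq
    · exact ⟨_, ⟨by positivity, hlt⟩, rfl⟩
    · refine ⟨0, ⟨le_rfl, by linarith [(Nat.cast_nonneg i : (0 : ℝ) ≤ i)]⟩, ?_⟩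
      rw [heq, h.polygon_zero, h.polygon_last]

theorem isPreconnected_curveOf : IsPreconnected (curveOf T) := by
  rw [← h.image_polygon]
  exact isPreconnected_Ico.image _ (continuous_polygon γ n).continuousOn

theorem isCircle : IsCircle (curveOf T) := by
  have h3 := h.three_le
  have hpos : (0 : ℝ) < n := by exact_mod_cast (show 0 < n by omega)
  have : Fact ((0 : ℝ) < n) := ⟨hpos⟩
  let F : AddCircle (n : ℝ) → ℝ × ℝ := AddCircle.liftIco (n : ℝ) 0 (polygon γ n)
  have hF : Continuous F := AddCircle.liftIco_continuous
    (by rw [zero_add, h.polygon_zero, h.polygon_last]) (continuous_polygon γ n).continuousOn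
  have hFt : ∀ t ∈ Ico (0 : ℝ) n, F t = polygon γ n t := fun t ht ↦
    AddCircle.liftIco_coe_apply (by simpa using ht)
  have hsurj : ∀ x : AddCircle (n : ℝ), ∃ t ∈ Ico (0 : ℝ) n, (t : AddCircle (n : ℝ)) = x := by
    intro x
    have hx := (AddCircle.equivIco (n : ℝ) 0 x).2
    exact ⟨_, ⟨hx.1, by linarith [hx.2]⟩, AddCircle.coe_equivIco⟩
  have hinj : Function.Injective F := by
    intro x y hxy
    obtain ⟨t, ht, rfl⟩ := hsurj x
    obtain ⟨r, hr, rfl⟩ := hsurj y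
    rw [hFt t ht, hFt r hr] at hxy
    rw [h.injOn_polygon ht hr hxy]
  have hrange : range F = curveOf T := by
    rw [← h.image_polygon]
    ext p
    constructor
    · rintro ⟨x, rfl⟩
      obtain ⟨t, ht, rfl⟩ := hsurj x
      exact ⟨t, ht, (hFt t ht).symm⟩
    · rintro ⟨t, ht, rfl⟩
      exact ⟨t, hFt t ht⟩
  let e : AddCircle (n : ℝ) ≃ₜ range F :=
    Continuous.homeoOfEquivCompactToT2 (f := Equiv.ofInjective F hinj)
      (hF.subtype_mk _)
  obtain ⟨g⟩ := nonempty_circle_homeomorph_sphere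
  rw [← hrange]
  exact ⟨e.symm.trans ((AddCircle.homeomorphCircle hpos.ne').trans g)⟩

end IsLoop

/-- The center of the cell with a given southwest corner. -/
noncomputable def center (c : ℤ × ℤ) : ℝ × ℝ := (c.1 + 1 / 2, c.2 + 1 / 2)

theorem center_mem_cell (c : ℤ × ℤ) : center c ∈ cell c.1 c.2 := by
  refine ⟨⟨?_, ?_⟩, ?_, ?_⟩ <;> simp only [center] <;> linarith

theorem isPreconnected_cell (a b : ℤ) : IsPreconnected (cell a b) :=
  isPreconnected_Ioo.prod isPreconnected_Ioo

theorem cell_subset_compl_curveOf (T : Set Stitch) (a b : ℤ) : cell a b ⊆ (curveOf T)ᶜ := by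
  rintro p ⟨⟨h1, h2⟩, h3, h4⟩ hp
  obtain ⟨s, -, hs⟩ := mem_curveOf.1 hp
  cases s with
  | vert x y =>
    rw [(mem_seg_vert.1 hs).1] at h1 h2
    norm_cast at h1 h2
    omega
  | horiz x y =>
    rw [(mem_seg_horiz.1 hs).1] at h3 h4
    norm_cast at h3 h4
    omega

theorem Step.connectedComponentIn_center_eq {T : Set Stitch} {c c' : ℤ × ℤ} (h : Step T c c') :
    connectedComponentIn (curveOf T)ᶜ (center c) =
      connectedComponentIn (curveOf T)ᶜ (center c') := by
  suffices ∃ A : Set (ℝ × ℝ), IsPreconnected A ∧ A ⊆ (curveOf T)ᶜ ∧ center c ∈ A ∧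
      center c' ∈ A by
    obtain ⟨A, hA, hAT, h1, h2⟩ := this
    exact connectedComponentIn_eq (hA.subset_connectedComponentIn h1 hAT h2)
  obtain ⟨a, b⟩ := c
  rcases h with ⟨rfl, hT⟩ | ⟨rfl, hT⟩
  · refine ⟨Ioo (a : ℝ) (a + 2) ×ˢ Ioo (b : ℝ) (b + 1),
      isPreconnected_Ioo.prod isPreconnected_Ioo, ?_, ?_, ?_⟩
    · rintro p ⟨⟨h1, h2⟩, h3, h4⟩ hp
      obtain ⟨s, hsT, hs⟩ := mem_curveOf.1 hp
      cases s with
      | vert x y =>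
        obtain ⟨e1, e2, e3⟩ := mem_seg_vert.1 hs
        rw [e1] at h1 h2
        have h5 := h3.trans_le e3
        have h6 := e2.trans_lt h4
        norm_cast at h1 h2 h5 h6
        obtain rfl : x = a + 1 := by omega
        obtain rfl : y = b := by omega
        exact hT hsT
      | horiz x y =>
        rw [(mem_seg_horiz.1 hs).1] at h3 h4
        norm_cast at h3 h4
        omega
    all_goals
      refine ⟨⟨?_, ?_⟩, ?_, ?_⟩ <;> simp only [center] <;> push_cast <;> linarith
  · refine ⟨Ioo (a : ℝ) (a + 1) ×ˢ Ioo (b : ℝ) (b + 2),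
      isPreconnected_Ioo.prod isPreconnected_Ioo, ?_, ?_, ?_⟩
    · rintro p ⟨⟨h1, h2⟩, h3, h4⟩ hp
      obtain ⟨s, hsT, hs⟩ := mem_curveOf.1 hp
      cases s with
      | vert x y =>
        rw [(mem_seg_vert.1 hs).1] at h1 h2
        norm_cast at h1 h2
        omega
      | horiz x y =>
        obtain ⟨e1, e2, e3⟩ := mem_seg_horiz.1 hs
        rw [e1] at h3 h4
        have h5 := h1.trans_le e3
        have h6 := e2.trans_lt h2
        norm_cast at h3 h4 h5 h6
        obtain rfl : y = b + 1 := by omega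
        obtain rfl : x = a := by omega
        exact hT hsT
    all_goals
      refine ⟨⟨?_, ?_⟩, ?_, ?_⟩ <;> simp only [center] <;> push_cast <;> linarith

namespace IsParity
variable {T : Set Stitch} {P : ℤ × ℤ → ZMod 2}

theorem mem_curveOf_of_mem_closedCell (hP : IsParity T P) {c c' : ℤ × ℤ} (hne : P c ≠ P c')
    {p : ℝ × ℝ} (hp : p ∈ closedCell c) (hp' : p ∈ closedCell c') : p ∈ curveOf T := by
  have hor : ∀ a a' b : ℤ, a < a' → P (a, b) ≠ P (a', b) → p ∈ closedCell (a, b) →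
      p ∈ closedCell (a', b) → p ∈ curveOf T := by
    rintro a a' b hlt hne ⟨⟨-, h1⟩, h3, h4⟩ ⟨⟨h2, -⟩, -⟩
    have h5 := h2.trans h1
    norm_cast at h5
    obtain rfl : a' = a + 1 := by omega
    have h6 := hP.vert (a + 1) b
    have hmem : Stitch.vert (a + 1) b ∈ T := by
      by_contra hn
      rw [ind, if_neg hn, add_sub_cancel_right, add_zero] at h6
      exact hne h6
    push_cast at h2
    exact mem_curveOf.2 ⟨_, hmem, mem_seg_vert.2 ⟨by push_cast; exact le_antisymm h1 h2, h3, h4⟩⟩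
  have ver : ∀ a b b' : ℤ, b < b' → P (a, b) ≠ P (a, b') → p ∈ closedCell (a, b) →
      p ∈ closedCell (a, b') → p ∈ curveOf T := by
    rintro a b b' hlt hne ⟨⟨h3, h4⟩, -, h1⟩ ⟨-, h2, -⟩
    have h5 := h2.trans h1
    norm_cast at h5
    obtain rfl : b' = b + 1 := by omega
    have h6 := hP.horiz a (b + 1)
    have hmem : Stitch.horiz a (b + 1) ∈ T := by
      by_contra hn
      rw [ind, if_neg hn, add_sub_cancel_right, add_zero] at h6
      exact hne h6
    push_cast at h2
    exact mem_curveOf.2 ⟨_, hmem, mem_seg_horiz.2 ⟨by push_cast; exact le_antisymm h1 h2, h3, h4⟩⟩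
  obtain ⟨a, b⟩ := c
  obtain ⟨a', b'⟩ := c'
  have hm : p ∈ closedCell (a', b) := ⟨hp'.1, hp.2⟩
  by_cases hP1 : P (a, b) = P (a', b)
  · rw [hP1] at hne
    rcases lt_trichotomy b b' with hlt | rfl | hlt
    · exact ver _ _ _ hlt hne hm hp'
    · exact absurd rfl hne
    · exact ver _ _ _ hlt hne.symm hp' hm
  · rcases lt_trichotomy a a' with hlt | rfl | hlt
    · exact hor _ _ _ hlt hP1 hp hm
    · exact absurd rfl hP1
    · exact hor _ _ _ hlt (Ne.symm hP1) hm hp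

theorem cell_subset_intOf (hP : IsParity T P) {c : ℤ × ℤ} (hc : P c = 1) :
    cell c.1 c.2 ⊆ intOf (curveOf T) := by
  intro p hp
  have hpT := cell_subset_compl_curveOf T _ _ hp
  refine ⟨hpT, ?_⟩
  let O : Set (ℝ × ℝ) := ⋃ c ∈ {c | P c ≠ 0}, closedCell c
  let Z : Set (ℝ × ℝ) := ⋃ c ∈ {c | P c = 0}, closedCell c
  have hclosed : ∀ c, IsClosed (closedCell c) := fun c ↦ isClosed_Icc.prod isClosed_Icc
  have hO : IsClosed O := hP.finite.isClosed_biUnion fun c _ ↦ hclosed c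
  have hZ : IsClosed Z := by
    simp only [Z, biUnion_eq_iUnion]
    exact (locallyFinite_closedCell.comp_injective Subtype.val_injective).isClosed_iUnion
      fun c ↦ hclosed c
  have hbdd : Bornology.IsBounded O :=
    (Bornology.isBounded_biUnion hP.finite).2 fun c _ ↦
      (Metric.isBounded_Icc _ _).prod (Metric.isBounded_Icc _ _)
  have hpO : p ∈ O := mem_biUnion (show P c ≠ 0 by simp [hc])
    ⟨Ioo_subset_Icc_self hp.1, Ioo_subset_Icc_self hp.2⟩
  have hOZ : O ∩ Z ⊆ curveOf T := by
    rintro q ⟨h1, h2⟩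
    simp only [O, Z, mem_iUnion, exists_prop] at h1 h2
    obtain ⟨c, hc, hq⟩ := h1
    obtain ⟨c', hc', hq'⟩ := h2
    exact hP.mem_curveOf_of_mem_closedCell (fun h ↦ hc (h.trans hc')) hq hq'
  have huniv : ∀ q, q ∈ O ∪ Z := by
    intro q
    have hq : q ∈ closedCell (⌊q.1⌋, ⌊q.2⌋) :=
      ⟨⟨Int.floor_le _, (Int.lt_floor_add_one _).le⟩, Int.floor_le _, (Int.lt_floor_add_one _).le⟩
    by_cases h : P (⌊q.1⌋, ⌊q.2⌋) = 0
    · exact Or.inr (mem_biUnion h hq)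
    · exact Or.inl (mem_biUnion h hq)
  have hsub := connectedComponentIn_subset (curveOf T)ᶜ p
  rcases isPreconnected_iff_subset_of_disjoint_closed.1
    (isPreconnected_connectedComponentIn (x := p) (F := (curveOf T)ᶜ)) O Z hO hZ
    (fun q _ ↦ huniv q)
    (eq_empty_of_forall_notMem fun q hq ↦ hsub hq.1 (hOZ hq.2)) with h | h
  · exact hbdd.subset h
  · exact absurd (hOZ ⟨hpO, h (mem_connectedComponentIn hpT)⟩) hpT

end IsParity

namespace IsLoop
variable {T : Set Stitch} {n : ℕ} {γ : ℕ → ℤ × ℤ} {P : ℤ × ℤ → ZMod 2}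

theorem not_isBounded_connectedComponentIn (h : IsLoop T n γ) (hT : TwoRegular T)
    (hP : IsParity T P) {c : ℤ × ℤ} (hc : P c = 0) {A : Set (ℝ × ℝ)} (hA : IsPreconnected A)
    (hAT : A ⊆ (curveOf T)ᶜ) (hcA : center c ∈ A) {p : ℝ × ℝ} (hp : p ∈ A) :
    ¬ Bornology.IsBounded (connectedComponentIn (curveOf T)ᶜ p) := by
  rw [connectedComponentIn_eq (hA.subset_connectedComponentIn hp hAT hcA)]
  intro hb
  obtain ⟨R, hR⟩ := isBounded_iff_forall_norm_le.1 hb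
  obtain ⟨N, hN⟩ := h.exists_reach_up hT hP hc
  have hy := (hN (max N ⌈R⌉) (le_max_left _ _)).map_eq
    (f := fun c ↦ connectedComponentIn (curveOf T)ᶜ (center c))
    fun _ _ hs ↦ hs.connectedComponentIn_center_eq
  have hmem := mem_connectedComponentIn
    (cell_subset_compl_curveOf T _ _ (center_mem_cell (c.1, max N ⌈R⌉)))
  rw [← hy] at hmem
  have h1 := (norm_snd_le _).trans (hR _ hmem)
  have h2 : (⌈R⌉ : ℝ) ≤ (max N ⌈R⌉ : ℤ) := by exact_mod_cast le_max_right N ⌈R⌉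
  have h3 := (le_abs_self _).trans h1
  simp only [center] at h3
  linarith [Int.le_ceil R]

theorem parity_eq_one_of_cell_subset_intOf (h : IsLoop T n γ) (hT : TwoRegular T)
    (hP : IsParity T P) {c : ℤ × ℤ} (hc : cell c.1 c.2 ⊆ intOf (curveOf T)) : P c = 1 := by
  have key : P c ≠ 0 := fun h0 ↦
    h.not_isBounded_connectedComponentIn hT hP h0 (isPreconnected_cell _ _)
      (cell_subset_compl_curveOf T _ _) (center_mem_cell c) (center_mem_cell c)
      (hc (center_mem_cell c)).2
  revert key
  generalize P c = z
  decide +revert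

theorem toPt_notMem_intOf (h : IsLoop T n γ) (hT : TwoRegular T) (hP : IsParity T P)
    {u : ℤ × ℤ} (hu : ∀ s ∈ T, u ∉ ends s) (h0 : P u = 0) : toPt u ∉ intOf (curveOf T) := by
  intro hpu
  refine h.not_isBounded_connectedComponentIn hT hP h0 (A := insert (toPt u) (cell u.1 u.2))
    ?_ ?_ (Or.inr (center_mem_cell u)) (Or.inl rfl) hpu.2
  · refine (isPreconnected_cell u.1 u.2).subset_closure (subset_insert _ _)
      (insert_subset ?_ subset_closure)
    rw [cell, closure_prod_eq, closure_Ioo (by simp), closure_Ioo (by simp)]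
    simp [toPt]
  · refine insert_subset (fun hmem ↦ ?_) (cell_subset_compl_curveOf T _ _)
    obtain ⟨s, hs, hus⟩ := mem_curveOf.1 hmem
    exact hu s hs (mem_ends_of_toPt_mem_seg hus)

end IsLoop

/-- A simple closed component of the curve of a pattern is traced by an oriented loop. -/
theorem exists_oriented_isLoop {S : Set Stitch} (hS : TwoRegular S) {p : ℝ × ℝ} {s : Stitch}
    (hcirc : IsCircle (connectedComponentIn (curveOf S) p)) (hs : s ∈ S)
    (hseg : s.seg ⊆ connectedComponentIn (curveOf S) p) {v : ℤ × ℤ} (hv : v ∈ ends s) :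
    ∃ T n γ P, IsLoop T n γ ∧ Isolated T S ∧ connectedComponentIn (curveOf S) p = curveOf T ∧
      IsParity T P ∧ γ 0 = v ∧ ∀ i, Out T P (γ i) (γ (i + 1)) := by
  have hcomp : IsCompact (connectedComponentIn (curveOf S) p) := by
    obtain ⟨e⟩ := hcirc
    have := isCompact_iff_compactSpace.1 (isCompact_sphere (0 : ℝ × ℝ) 1)
    exact isCompact_iff_compactSpace.2 e.symm.compactSpace
  obtain ⟨hfin, hiso⟩ := exists_isolated_finite hcomp
  set C := {s ∈ S | s.seg ⊆ connectedComponentIn (curveOf S) p}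
  have hC := hiso.twoRegular hS
  obtain ⟨P, hP⟩ := hC.exists_isParity hfin
  obtain ⟨n, γ, h3, hinj, hcl, h0, hout⟩ :=
    exists_oriented_walk hC hP hfin (show s ∈ C from ⟨hs, hseg⟩) hv
  let T : Set Stitch := {t | ∃ i < n, t = edge (γ i) (γ (i + 1))}
  have hT : IsLoop T n γ := ⟨h3, hinj, hcl, fun i _ ↦ (hout i).1, fun t ↦ Iff.rfl⟩
  have hTC : T ⊆ C := by
    rintro t ⟨i, -, rfl⟩
    exact (hout i).2.1
  have hTS := hT.isolated (hTC.trans hiso.1) hS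
  have hcurve : connectedComponentIn (curveOf S) p = curveOf T := by
    have hmem := hT.edge_mem (show 0 < n by omega)
    rw [connectedComponentIn_eq (hseg (toPt_mem_seg hv))]
    refine hTS.connectedComponentIn_eq hT.isPreconnected_curveOf
      (seg_subset_curveOf hmem (toPt_mem_seg ?_))
    rw [ends_edge (hout 0).1, h0]
    exact Or.inl rfl
  have hCT : C = T := Subset.antisymm
    (fun t ht ↦ mem_of_seg_subset_curveOf (hcurve ▸ ht.2)) hTC
  rw [hCT] at hP hout
  exact ⟨T, n, γ, P, hT, hTS, hcurve, hP, h0, hout⟩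

/-- `T₁` and `T₂` are the vertex-disjoint pieces into which `T` breaks under a local move. -/
structure IsSplit (k j : ℤ) (T T₁ T₂ : Set Stitch) : Prop where
  disjoint : VertexDisjoint T₁ T₂
  bottom : Stitch.horiz k j ∈ T₁
  top : Stitch.horiz k (j + 1) ∈ T₂
  mem_iff : ∀ s, s ∈ T₁ ∨ s ∈ T₂ ↔ (s ∈ T ∧ s ≠ .vert k j ∧ s ≠ .vert (k + 1) j) ∨
    s = .horiz k j ∨ s = .horiz k (j + 1)

theorem IsLoop.exists_isSplit {T : Set Stitch} {n : ℕ} {γ : ℕ → ℤ × ℤ} {P : ℤ × ℤ → ZMod 2}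
    {k j : ℤ} (h : IsLoop T n γ) (hT : TwoRegular T) (hP : IsParity T P) (h0 : γ 0 = (k, j))
    (hout : ∀ i, Out T P (γ i) (γ (i + 1))) (hv1 : Stitch.vert k j ∈ T)
    (hv2 : Stitch.vert (k + 1) j ∈ T) (hh1 : Stitch.horiz k j ∉ T)
    (hh2 : Stitch.horiz k (j + 1) ∉ T) (hPkj : P (k, j) = 1) :
    ∃ T₁ T₂ n₁ n₂ γ₁ γ₂, IsLoop T₁ n₁ γ₁ ∧ IsLoop T₂ n₂ γ₂ ∧ IsSplit k j T T₁ T₂ := by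
  have h3 := h.three_le
  have hab : Out T P (k, j + 1) (k, j) := by
    refine ⟨by simp [Adj], by simpa [edge] using hv1, ?_⟩
    simpa [left] using hPkj
  have hcd : Out T P (k + 1, j) (k + 1, j + 1) := by
    refine ⟨by simp [Adj], by simpa [edge] using hv2, ?_⟩
    simpa [left] using hPkj
  obtain ⟨i, hi, hia⟩ := h.exists_of_mem_ends hv1 (u := (k, j + 1)) (by simp [ends])
  obtain ⟨m, hm, hmc⟩ := h.exists_of_mem_ends hv2 (u := (k + 1, j)) (by simp [ends])
  have hib : γ (i + 1) = (k, j) := (hia ▸ hout i).right_unique hT hP hab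
  have hmd : γ (m + 1) = (k + 1, j + 1) := (hmc ▸ hout m).right_unique hT hP hcd
  have hin : n = i + 1 := by
    by_contra hne
    have := h.injOn (show i + 1 < n by omega) (show 0 < n by omega) (hib.trans h0.symm)
    omega
  have hm0 : m ≠ 0 := by
    rintro rfl
    simp [h0] at hmc
  have hm1 : m ≠ 1 := by
    rintro rfl
    have := (hout 0).2.1
    rw [zero_add, ← hmc, h0, edge_east] at this
    exact hh1 this
  have hmi : m ≠ i := by
    rintro rfl
    simp [← hia] at hmc
  have hmi1 : m + 1 ≠ i := by
    rintro rfl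
    simp [← hia] at hmd
  have hmi2 : m + 2 ≠ i := by
    rintro rfl
    have := (hout (m + 1)).2.1
    rw [hmd, ← hia, edge_comm (by simp [Adj]), edge_east] at this
    exact hh2 this
  obtain ⟨M, rfl⟩ : ∃ M, i = m + 1 + M := ⟨i - (m + 1), by omega⟩
  subst hin
  have he1 : edge (γ m) (γ 0) = .horiz k j := by
    rw [← hmc, h0, edge_comm (by simp [Adj]), edge_east]
  have he2 : edge (γ (m + 1 + M)) (γ (m + 1)) = .horiz k (j + 1) := by
    rw [hmd, ← hia, edge_east]
  have hem : edge (γ m) (γ (m + 1)) = .vert (k + 1) j := by rw [← hmc, hmd, edge_north]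
  have hei : edge (γ (m + 1 + M)) (γ (m + 1 + M + 1)) = .vert k j := by
    rw [hib, ← hia, edge_comm (by simp [Adj]), edge_north]
  have l1 := h.closedArc (s := 0) (M := m) (by omega) (by omega)
    (by rw [zero_add, ← hmc, h0]; simp [Adj])
  have l2 := h.closedArc (s := m + 1) (M := M) (by omega) (by omega)
    (by rw [hmd, ← hia]; simp [Adj])
  refine ⟨_, _, _, _, _, _, l1, l2, ?_, Or.inr (by rw [zero_add, he1]), Or.inr he2.symm, fun s ↦ ?_⟩
  · intro s hs t ht
    refine Set.disjoint_left.2 fun u hus hut ↦ ?_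
    obtain ⟨a, ha, rfl⟩ := l1.exists_of_mem_ends hs hus
    obtain ⟨b, hb, hab⟩ := l2.exists_of_mem_ends ht hut
    rw [Nat.mod_eq_of_lt ha, Nat.mod_eq_of_lt hb] at hab
    have := h.injOn (show 0 + a < m + 1 + M + 1 by omega)
      (show m + 1 + b < m + 1 + M + 1 by omega) hab
    omega
  · simp only [Hitomezashi.closedArc, mem_ofPred_eq, he1, he2, zero_add]
    have hne : ∀ a < m + 1 + M + 1, a ≠ m → a ≠ m + 1 + M →
        edge (γ a) (γ (a + 1)) ≠ .vert k j ∧ edge (γ a) (γ (a + 1)) ≠ .vert (k + 1) j := by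
      intro a ha ham hai
      rw [← hei, ← hem]
      exact ⟨fun e ↦ hai (h.eq_of_edge_eq ha (by omega) e),
        fun e ↦ ham (h.eq_of_edge_eq ha (by omega) e)⟩
    constructor
    · rintro ((⟨a, ha, rfl⟩ | hs) | ⟨a, ha, rfl⟩ | hs)
      · exact Or.inl ⟨h.edge_mem (by omega), hne a (by omega) (by omega) (by omega)⟩
      · exact Or.inr (Or.inl hs)
      · exact Or.inl ⟨h.edge_mem (by omega), hne _ (by omega) (by omega) (by omega)⟩
      · exact Or.inr (Or.inr hs)
    · rintro (⟨hs, hs1, hs2⟩ | hs | hs)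
      · obtain ⟨a, ha, rfl⟩ := (h.mem_iff s).1 hs
        have ham : a ≠ m := by
          rintro rfl
          exact hs2 hem
        have hai : a ≠ m + 1 + M := by
          rintro rfl
          exact hs1 hei
        by_cases hlt : a < m
        · exact Or.inl (Or.inl ⟨a, hlt, rfl⟩)
        · obtain ⟨b, rfl⟩ : ∃ b, a = m + 1 + b := ⟨a - (m + 1), by omega⟩
          exact Or.inr (Or.inl ⟨b, by omega, rfl⟩)
      · exact Or.inl (Or.inr hs)
      · exact Or.inr (Or.inr hs)

theorem VertexDisjoint.parity_eq_zero {T T' : Set Stitch} (hd : VertexDisjoint T T')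
    {P : ℤ × ℤ → ZMod 2} (hP : IsParity T' P) (h0 : ∀ s ∈ T, ∀ u ∈ ends s, P u = 0) {k y : ℤ}
    (hy : Stitch.vert k y ∈ T ∨ Stitch.vert (k + 1) y ∈ T) : P (k, y) = 0 := by
  rcases hy with hy | hy
  · exact h0 _ hy _ (by simp [ends])
  · have h1 := h0 _ hy (k + 1, y) (by simp [ends])
    have h2 := hP.vert (k + 1) y
    have h3 : Stitch.vert (k + 1) y ∉ T' := hd.notMem hy (u := (k + 1, y)) (by simp [ends])
      (by simp [ends])
    rwa [add_sub_cancel_right, h1, ind, if_neg h3, add_zero] at h2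

namespace IsSplit
variable {k j : ℤ} {T T₁ T₂ : Set Stitch} {n₁ n₂ : ℕ} {γ₁ γ₂ : ℕ → ℤ × ℤ}
  {P P₁ P₂ : ℤ × ℤ → ZMod 2}

theorem top_notMem (h : IsSplit k j T T₁ T₂) : Stitch.horiz k (j + 1) ∉ T₁ :=
  h.disjoint.symm.notMem h.top (u := (k, j + 1)) (by simp [ends]) (by simp [ends])

theorem bottom_notMem (h : IsSplit k j T T₁ T₂) : Stitch.horiz k j ∉ T₂ :=
  h.disjoint.notMem h.bottom (u := (k, j)) (by simp [ends]) (by simp [ends])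

theorem parity_add (h : IsSplit k j T T₁ T₂) (hh1 : Stitch.horiz k j ∉ T)
    (hh2 : Stitch.horiz k (j + 1) ∉ T) (hP : IsParity T P) (hP₁ : IsParity T₁ P₁)
    (hP₂ : IsParity T₂ P₂) (c : ℤ × ℤ) :
    P c = P₁ c + P₂ c + if c = (k, j) then 1 else 0 := by
  refine hP.add hP₁ hP₂ (fun x y ↦ ?_) c
  have hb := h.bottom
  have ht := h.top
  have hb' := h.bottom_notMem
  have ht' := h.top_notMem
  by_cases hxy : x = k ∧ (y = j ∨ y = j + 1)
  · rw [if_pos hxy]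
    obtain ⟨rfl, rfl | rfl⟩ := hxy
    · simp only [ind, hb, hb', hh1, if_true, if_false]
      decide
    · simp only [ind, ht, ht', hh2, if_true, if_false]
      decide
  · rw [if_neg hxy]
    have hm := h.mem_iff (.horiz x y)
    have hn : Stitch.horiz x y ∈ T₁ → Stitch.horiz x y ∉ T₂ := fun h1 ↦
      h.disjoint.notMem h1 (u := (x, y)) (by simp [ends]) (by simp [ends])
    simp only [ne_eq, reduceCtorEq, not_false_eq_true, and_true, Stitch.horiz.injEq] at hm
    unfold ind
    split_ifs <;> first | decide | (exfalso; tauto)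

/-- The two pieces lie outside each other. -/
theorem parity_eq_zero (h : IsSplit k j T T₁ T₂) (hh1 : Stitch.horiz k j ∉ T)
    (hh2 : Stitch.horiz k (j + 1) ∉ T) (hP : IsParity T P) (hP₁ : IsParity T₁ P₁)
    (hP₂ : IsParity T₂ P₂) (h₁ : IsLoop T₁ n₁ γ₁) (h₂ : IsLoop T₂ n₂ γ₂) (hPkj : P (k, j) = 1) :
    (∀ s ∈ T₁, ∀ u ∈ ends s, P₂ u = 0) ∧ ∀ s ∈ T₂, ∀ u ∈ ends s, P₁ u = 0 := by
  have hadd := h.parity_add hh1 hh2 hP hP₁ hP₂ (k, j)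
  rw [hPkj, if_pos rfl] at hadd
  obtain ⟨i, hi, hib⟩ := h₁.exists_of_mem_ends h.bottom (u := (k, j)) (by simp [ends])
  obtain ⟨l, hl, hla⟩ := h₂.exists_of_mem_ends h.top (u := (k, j + 1)) (by simp [ends])
  have c₁ : ∀ m < n₁, P₂ (γ₁ m) = P₂ (k, j) := fun m hm ↦
    (h₁.parity_const h.disjoint hP₂ hm).trans
      (hib ▸ (h₁.parity_const h.disjoint hP₂ hi).symm)
  have hup := hP₁.horiz k (j + 1)
  rw [add_sub_cancel_right, ind, if_neg h.top_notMem, add_zero] at hup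
  have c₂ : ∀ m < n₂, P₁ (γ₂ m) = P₁ (k, j) := fun m hm ↦
    (h₂.parity_const h.disjoint.symm hP₁ hm).trans
      (hup ▸ hla ▸ (h₂.parity_const h.disjoint.symm hP₁ hl).symm)
  have heq : P₁ (k, j) = P₂ (k, j) := by
    revert hadd
    generalize P₁ (k, j) = a
    generalize P₂ (k, j) = b
    decide +revert
  have hzero : P₁ (k, j) = 0 := by
    by_contra hne
    exact h₁.not_mutually_inside h₂ hP₁ hP₂ (fun m hm ↦ by rwa [c₁ m hm, ← heq])
      (fun m hm ↦ by rwa [c₂ m hm])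
  constructor
  · intro s hs u hu
    obtain ⟨m, hm, rfl⟩ := h₁.exists_of_mem_ends hs hu
    rw [c₁ m hm, ← heq, hzero]
  · intro s hs u hu
    obtain ⟨m, hm, rfl⟩ := h₂.exists_of_mem_ends hs hu
    rw [c₂ m hm, hzero]

end IsSplit

/-- A piece of a split is agreeable. -/
theorem agreeableAt_curveOf {k j : ℤ} {T T₁ T₂ : Set Stitch} {P P₁ P₂ : ℤ × ℤ → ZMod 2}
    (hd : VertexDisjoint T₁ T₂) (hP₁ : IsParity T₁ P₁) (hP₂ : IsParity T₂ P₂)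
    (h0 : ∀ s ∈ T₁, ∀ u ∈ ends s, P₂ u = 0)
    (hadd : ∀ c, P c = P₁ c + P₂ c + if c = (k, j) then 1 else 0)
    (hv1 : Stitch.vert k j ∉ T₁) (hv2 : Stitch.vert (k + 1) j ∉ T₁)
    (hmem : ∀ x y, Stitch.vert x y ∈ T₁ → Stitch.vert x y ∈ T)
    (hP : ∀ y, Stitch.vert k y ∈ T ∨ Stitch.vert (k + 1) y ∈ T → P (k, y) = 1) :
    AgreeableAt k (curveOf T₁) := by
  intro y hy
  replace hy := hy.imp mem_of_seg_subset_curveOf mem_of_seg_subset_curveOf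
  have hyj : y ≠ j := by
    rintro rfl
    exact hy.elim hv1 hv2
  have h1 := hadd (k, y)
  rw [hP y (hy.imp (hmem _ _) (hmem _ _)), hd.parity_eq_zero hP₂ h0 hy,
    if_neg (by simpa using hyj), add_zero, add_zero] at h1
  exact hP₁.cell_subset_intOf (c := (k, y)) h1.symm

/-- A loop that meets the exterior of a vertex-disjoint loop is not inside it. -/
theorem IsLoop.not_curveOf_subset_intOf {T T' : Set Stitch} {n : ℕ} {γ : ℕ → ℤ × ℤ}
    {P : ℤ × ℤ → ZMod 2} (h : IsLoop T' n γ) (hT : TwoRegular T') (hP : IsParity T' P)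
    (hd : VertexDisjoint T T') {s : Stitch} (hs : s ∈ T) {u : ℤ × ℤ} (hu : u ∈ ends s)
    (h0 : P u = 0) : ¬ curveOf T ⊆ intOf (curveOf T') := fun hsub ↦
  h.toPt_notMem_intOf hT hP (fun _ ht hut ↦ hd.notMem hs hu hut ht) h0
    (hsub (seg_subset_curveOf hs (toPt_mem_seg hu)))

end Hitomezashi

open Hitomezashi

/-- Let `CL` be an agreeable pseudo-hitomezashi loop admitting a split
at longitude `k + 1/2` (a local move whose two deleted vertical stitches both lie on
`CL`), and let `L1` and `L2` be the pseudo-hitomezashi strands into which `CL` breaks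
when the split is applied (the components of the resulting pattern containing the two new
horizontal stitches). Then `L1` and `L2` are agreeable pseudo-hitomezashi loops and
neither is contained in the interior of the other. -/
theorem hitomezashi_split (ε η : ℤ → ZMod 2) (k : ℤ) (hk : ε k = ε (k+1))
    (S0 : Set Stitch) (hS0 : IsPseudoPattern ε η k S0) (j : ℤ)
    (hv1 : Stitch.vert k j ∈ S0) (hv2 : Stitch.vert (k+1) j ∈ S0)
    (hh1 : Stitch.horiz k j ∉ S0) (hh2 : Stitch.horiz k (j+1) ∉ S0)
    (CL : Set (ℝ × ℝ))
    (hCL : ∃ p ∈ curveOf S0, CL = connectedComponentIn (curveOf S0) p)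
    (hLoop : IsCircle CL)
    (hsplit : (Stitch.vert k j).seg ⊆ CL ∧ (Stitch.vert (k+1) j).seg ⊆ CL)
    (hagree : AgreeableAt k CL)
    (S1 : Set Stitch)
    (hS1 : S1 = (S0 \ {Stitch.vert k j, Stitch.vert (k+1) j}) ∪
      {Stitch.horiz k j, Stitch.horiz k (j+1)})
    (L1 L2 : Set (ℝ × ℝ))
    (hL1 : ∃ p ∈ (Stitch.horiz k j).seg, L1 = connectedComponentIn (curveOf S1) p)
    (hL2 : ∃ p ∈ (Stitch.horiz k (j+1)).seg, L2 = connectedComponentIn (curveOf S1) p) :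
    L1 ≠ L2 ∧ IsCircle L1 ∧ IsCircle L2 ∧ AgreeableAt k L1 ∧ AgreeableAt k L2 ∧
    ¬ L1 ⊆ intOf L2 ∧ ¬ L2 ⊆ intOf L1 := by
  have hS0' := twoRegular_of_isPseudoPattern hS0
  have hS1' : TwoRegular S1 := hS0'.localMove ⟨j, hv1, hv2, hh1, hh2, hS1⟩
  obtain ⟨p, -, rfl⟩ := hCL
  obtain ⟨T, n, γ, P, hT, hTS, hcurve, hP, h0, hout⟩ := exists_oriented_isLoop hS0' hLoop hv1
    hsplit.1 (v := (k, j)) (by simp [ends])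
  rw [hcurve] at hsplit hagree
  have hT' := hTS.twoRegular hS0'
  have hT1 := mem_of_seg_subset_curveOf hsplit.1
  have hT2 := mem_of_seg_subset_curveOf hsplit.2
  have hPv : ∀ y, Stitch.vert k y ∈ T ∨ Stitch.vert (k + 1) y ∈ T → P (k, y) = 1 := fun y hy ↦
    hT.parity_eq_one_of_cell_subset_intOf hT' hP (c := (k, y))
      (hagree y (hy.imp seg_subset_curveOf seg_subset_curveOf))
  have hPkj := hPv j (Or.inl hT1)
  have hb : Stitch.horiz k j ∉ T := fun h ↦ hh1 (hTS.1 h)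
  have ht : Stitch.horiz k (j + 1) ∉ T := fun h ↦ hh2 (hTS.1 h)
  obtain ⟨T₁, T₂, n₁, n₂, γ₁, γ₂, l₁, l₂, hs⟩ :=
    hT.exists_isSplit hT' hP h0 hout hT1 hT2 hb ht hPkj
  have hsub : ∀ s, s ∈ T₁ ∨ s ∈ T₂ → s ∈ S1 := by
    intro s h
    rw [hS1]
    rcases (hs.mem_iff s).1 h with ⟨h1, h2, h3⟩ | h | h
    · exact Or.inl ⟨hTS.1 h1, by simp [h2, h3]⟩
    · exact Or.inr (Or.inl h)
    · exact Or.inr (Or.inr h)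
  have hvert : ∀ x y, Stitch.vert x y ∈ T₁ ∨ Stitch.vert x y ∈ T₂ → Stitch.vert x y ∈ T ∧
      Stitch.vert x y ≠ .vert k j ∧ Stitch.vert x y ≠ .vert (k + 1) j := by
    intro x y h
    simpa using (hs.mem_iff _).1 h
  have hi₁ := l₁.isolated (fun s h ↦ hsub s (Or.inl h)) hS1'
  have hi₂ := l₂.isolated (fun s h ↦ hsub s (Or.inr h)) hS1'
  have hr₁ := hi₁.twoRegular hS1'
  have hr₂ := hi₂.twoRegular hS1'
  obtain ⟨P₁, hP₁⟩ := hr₁.exists_isParity l₁.finite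
  obtain ⟨P₂, hP₂⟩ := hr₂.exists_isParity l₂.finite
  have hadd := hs.parity_add hb ht hP hP₁ hP₂
  obtain ⟨z₁, z₂⟩ := hs.parity_eq_zero hb ht hP hP₁ hP₂ l₁ l₂ hPkj
  obtain ⟨q₁, hq₁, rfl⟩ := hL1
  obtain ⟨q₂, hq₂, rfl⟩ := hL2
  rw [hi₁.connectedComponentIn_eq l₁.isPreconnected_curveOf (seg_subset_curveOf hs.bottom hq₁),
    hi₂.connectedComponentIn_eq l₂.isPreconnected_curveOf (seg_subset_curveOf hs.top hq₂)]
  refine ⟨fun he ↦ ?_, l₁.isCircle, l₂.isCircle, ?_, ?_, ?_, ?_⟩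
  · exact hs.bottom_notMem (mem_of_seg_subset_curveOf (he ▸ seg_subset_curveOf hs.bottom))
  · exact agreeableAt_curveOf hs.disjoint hP₁ hP₂ z₁ hadd
      (fun h ↦ (hvert _ _ (Or.inl h)).2.1 rfl) (fun h ↦ (hvert _ _ (Or.inl h)).2.2 rfl)
      (fun x y h ↦ (hvert x y (Or.inl h)).1) hPv
  · exact agreeableAt_curveOf hs.disjoint.symm hP₂ hP₁ z₂
      (fun c ↦ (hadd c).trans (by rw [add_comm (P₁ c)]))
      (fun h ↦ (hvert _ _ (Or.inr h)).2.1 rfl) (fun h ↦ (hvert _ _ (Or.inr h)).2.2 rfl)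
      (fun x y h ↦ (hvert x y (Or.inr h)).1) hPv
  · exact l₂.not_curveOf_subset_intOf hr₂ hP₂ hs.disjoint hs.bottom (u := (k, j))
      (by simp [ends]) (z₁ _ hs.bottom _ (by simp [ends]))
  · exact l₁.not_curveOf_subset_intOf hr₁ hP₁ hs.disjoint.symm hs.top (u := (k, j + 1))
      (by simp [ends]) (z₂ _ hs.top _ (by simp [ends]))
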